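/- arXiv:2107.12693 — 3 statements merged into one kernel-verified Lean document; each statement's English description precedes it below -/
import Mathlib

section
/- Let n ≥ 1, and for i,j = 1,…,n let α_{ij} ∈ (0,1], let k_{ij} : D → ℝ be continuous on the triangle D = {(t,s) : 0 ≤ s ≤ t ≤ 1}, and let g_i : [0,1] → ℝ be continuous. Then there exists a unique continuous function Y = (y_1,…,y_n) : [0,1] → ℝⁿ satisfying the system of generalized Abel–Volterra integral equations y_i(t) = g_i(t) + ∑_{j=1}^{n} ∫₀ᵗ (t−s)^{α_{ij}−1} k_{ij}(t,s) y_j(s) ds for all t ∈ [0,1] and i = 1,…,n. -/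
open MeasureTheory Set intervalIntegral

/-- The closed triangle `0 ≤ s ≤ t ≤ 1` of pairs `(t, s)`. -/
def volterraTriangle : Set (ℝ × ℝ) := {p : ℝ × ℝ | 0 ≤ p.2 ∧ p.2 ≤ p.1 ∧ p.1 ≤ 1}

lemma isCompact_volterraTriangle : IsCompact volterraTriangle := by
  refine ((isCompact_Icc (a := (0 : ℝ)) (b := 1)).prod
    (isCompact_Icc (a := (0 : ℝ)) (b := 1))).of_isClosed_subset ?_ ?_
  · exact (isClosed_le continuous_const continuous_snd).inter
      ((isClosed_le continuous_snd continuous_fst).inter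
        (isClosed_le continuous_fst continuous_const))
  · rintro ⟨t, s⟩ ⟨h₀, h₁, h₂⟩
    exact ⟨⟨h₀.trans h₁, h₂⟩, h₀, h₁.trans h₂⟩

lemma intervalIntegrable_sub_rpow {a : ℝ} (ha : 0 < a) (t : ℝ) :
    IntervalIntegrable (fun s : ℝ => (t - s) ^ (a - 1)) volume 0 t := by
  have h := ((intervalIntegrable_rpow' (a := 0) (b := t)
    (by linarith : -1 < a - 1)).comp_sub_left t).symm
  simpa using h

lemma continuousOn_section_volterraTriangle {f : ℝ → ℝ → ℝ}
    (hf : ContinuousOn (fun p : ℝ × ℝ => f p.1 p.2) volterraTriangle) {t : ℝ}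
    (ht : t ∈ Icc (0 : ℝ) 1) : ContinuousOn (f t) (Icc 0 t) :=
  hf.comp (f := fun s : ℝ => (t, s)) (by fun_prop) fun _ hs => ⟨hs.1, hs.2, ht.2⟩

lemma intervalIntegrable_abel {a : ℝ} (ha : 0 < a) {f : ℝ → ℝ → ℝ}
    (hf : ContinuousOn (fun p : ℝ × ℝ => f p.1 p.2) volterraTriangle) {t : ℝ}
    (ht : t ∈ Icc (0 : ℝ) 1) :
    IntervalIntegrable (fun s => (t - s) ^ (a - 1) * f t s) volume 0 t := by
  refine (intervalIntegrable_sub_rpow ha t).mul_continuousOn ?_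
  rw [uIcc_of_le ht.1]
  exact continuousOn_section_volterraTriangle hf ht

lemma integral_abel_eq_rpow_mul {a : ℝ} (ha : 0 < a) (f : ℝ → ℝ) {t : ℝ} (ht : 0 ≤ t) :
    ∫ s in (0 : ℝ)..t, (t - s) ^ (a - 1) * f s =
      t ^ a * ∫ x in (0 : ℝ)..1, (1 - x) ^ (a - 1) * f (t * x) := by
  rcases ht.eq_or_lt with rfl | ht
  · simp [Real.zero_rpow ha.ne']
  have h := intervalIntegral.mul_integral_comp_mul_left (a := 0) (b := 1)
    (f := fun s => (t - s) ^ (a - 1) * f s) t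
  rw [mul_zero, mul_one] at h
  rw [← h, ← intervalIntegral.integral_const_mul, ← intervalIntegral.integral_const_mul]
  refine intervalIntegral.integral_congr fun x hx => ?_
  rw [uIcc_of_le zero_le_one] at hx
  have hpow : t ^ a = t * t ^ (a - 1) := by
    rw [Real.rpow_sub_one ht.ne']
    field_simp
  have hsub : t - t * x = t * (1 - x) := by ring
  simp only [hsub, Real.mul_rpow ht.le (sub_nonneg.2 hx.2), hpow]
  ring

lemma continuousOn_integral_abel {a : ℝ} (ha : 0 < a) {f : ℝ → ℝ → ℝ}
    (hf : ContinuousOn (fun p : ℝ × ℝ => f p.1 p.2) volterraTriangle) :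
    ContinuousOn (fun t => ∫ s in (0 : ℝ)..t, (t - s) ^ (a - 1) * f t s) (Icc 0 1) := by
  refine ContinuousOn.congr (f := fun t => t ^ a * ∫ x in (0 : ℝ)..1,
    (1 - x) ^ (a - 1) * f t (t * x)) ?_ fun t ht => integral_abel_eq_rpow_mul ha (f t) ht.1
  refine (Real.continuous_rpow_const ha.le).continuousOn.mul fun t₀ ht₀ => ?_
  obtain ⟨C, hC⟩ := isCompact_volterraTriangle.exists_bound_of_continuousOn hf
  have hmem : ∀ t ∈ Icc (0 : ℝ) 1, ∀ x ∈ Icc (0 : ℝ) 1, (t, t * x) ∈ volterraTriangle :=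
    fun t ht x hx => ⟨mul_nonneg ht.1 hx.1, mul_le_of_le_one_right ht.1 hx.2, ht.2⟩
  refine intervalIntegral.continuousWithinAt_of_dominated_interval
    (bound := fun x => (1 - x) ^ (a - 1) * C) ?_ ?_ ?_ ?_
  · filter_upwards [self_mem_nhdsWithin] with t ht
    refine (intervalIntegrable_sub_rpow ha 1).aestronglyMeasurable_restrict_uIoc.mul ?_
    rw [uIoc_of_le zero_le_one]
    refine ContinuousOn.aestronglyMeasurable ?_ measurableSet_Ioc
    exact hf.comp (f := fun x : ℝ => (t, t * x)) (by fun_prop)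
      fun x hx => hmem t ht x (Ioc_subset_Icc_self hx)
  · filter_upwards [self_mem_nhdsWithin] with t ht
    refine Filter.Eventually.of_forall fun x hx => ?_
    rw [uIoc_of_le zero_le_one] at hx
    have hx0 : 0 ≤ (1 - x) ^ (a - 1) := Real.rpow_nonneg (sub_nonneg.2 hx.2) _
    rw [norm_mul, Real.norm_of_nonneg hx0]
    exact mul_le_mul_of_nonneg_left (hC _ (hmem t ht x (Ioc_subset_Icc_self hx))) hx0
  · exact (intervalIntegrable_sub_rpow ha 1).mul_const C
  · refine Filter.Eventually.of_forall fun x hx => ?_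
    rw [uIoc_of_le zero_le_one] at hx
    refine ContinuousWithinAt.mul continuousWithinAt_const ?_
    exact hf.comp (f := fun t : ℝ => (t, t * x)) (by fun_prop)
      (fun t ht => hmem t ht x (Ioc_subset_Icc_self hx)) t₀ ht₀

lemma integral_sub_rpow_mul_exp_le {a : ℝ} (ha : 0 < a) {r : ℝ} (hr : 0 < r) {t : ℝ}
    (ht : 0 ≤ t) :
    ∫ s in (0 : ℝ)..t, (t - s) ^ (a - 1) * Real.exp (-(r * (t - s))) ≤
      (1 / r) ^ a * Real.Gamma a := by
  rw [intervalIntegral.integral_comp_sub_left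
    (fun x => x ^ (a - 1) * Real.exp (-(r * x))) t, sub_self, sub_zero,
    intervalIntegral.integral_of_le ht, ← Real.integral_rpow_mul_exp_neg_mul_Ioi ha hr]
  have hint : IntegrableOn (fun x : ℝ => x ^ (a - 1) * Real.exp (-(r * x))) (Ioi 0) := by
    simpa using integrableOn_rpow_mul_exp_neg_mul_rpow (s := a - 1) (p := 1) (by linarith)
      one_pos hr
  refine setIntegral_mono_set hint ?_ Ioc_subset_Ioi_self.eventuallyLE
  filter_upwards [ae_restrict_mem measurableSet_Ioi] with x hx
  exact mul_nonneg (Real.rpow_nonneg (le_of_lt hx) _) (Real.exp_pos _).le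

lemma abs_integral_abel_le {a : ℝ} (ha : 0 < a) {r : ℝ} (hr : 0 < r) {t : ℝ} (ht : 0 ≤ t)
    {f : ℝ → ℝ} {C : ℝ} (hC : 0 ≤ C)
    (hf : ∀ s ∈ Icc 0 t, |f s| ≤ C * Real.exp (-(r * (t - s)))) :
    |∫ s in (0 : ℝ)..t, (t - s) ^ (a - 1) * f s| ≤ C * ((1 / r) ^ a * Real.Gamma a) := by
  calc |∫ s in (0 : ℝ)..t, (t - s) ^ (a - 1) * f s|
      ≤ ∫ s in (0 : ℝ)..t, C * ((t - s) ^ (a - 1) * Real.exp (-(r * (t - s)))) := by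
        refine intervalIntegral.norm_integral_le_of_norm_le (E := ℝ) ht ?_ ?_
        · refine Filter.Eventually.of_forall fun s hs => ?_
          have h0 : 0 ≤ (t - s) ^ (a - 1) := Real.rpow_nonneg (sub_nonneg.2 hs.2) _
          rw [norm_mul, Real.norm_of_nonneg h0, Real.norm_eq_abs, mul_left_comm]
          exact mul_le_mul_of_nonneg_left (hf s (Ioc_subset_Icc_self hs)) h0
        · exact ((intervalIntegrable_sub_rpow ha t).mul_continuousOn (by fun_prop)).const_mul C
    _ ≤ C * ((1 / r) ^ a * Real.Gamma a) := by
        rw [intervalIntegral.integral_const_mul]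
        exact mul_le_mul_of_nonneg_left (integral_sub_rpow_mul_exp_le ha hr ht) hC

/-- A system of Abel–Volterra equations whose kernels decay like `exp (-r (t - s))` with a
sufficiently small total weight has a unique continuous solution. -/
lemma exists_unique_abel_of_sum_lt_one {ι : Type*} [Fintype ι] {a : ι → ι → ℝ}
    (ha : ∀ i j, 0 < a i j) {r : ℝ} (hr : 0 < r) {h : ι → ι → ℝ → ℝ → ℝ}
    (hh : ∀ i j, ContinuousOn (fun p : ℝ × ℝ => h i j p.1 p.2) volterraTriangle)
    {M : ι → ι → ℝ} (hM : ∀ i j, 0 ≤ M i j)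
    (hbound : ∀ i j, ∀ p ∈ volterraTriangle,
      |h i j p.1 p.2| ≤ M i j * Real.exp (-(r * (p.1 - p.2))))
    (hsmall : ∑ i, ∑ j, M i j * ((1 / r) ^ a i j * Real.Gamma (a i j)) < 1)
    {g : ι → ℝ → ℝ} (hg : ∀ i, ContinuousOn (g i) (Icc 0 1)) :
    ∃! u : ι → C(Icc (0 : ℝ) 1, ℝ), ∀ i, ∀ t : Icc (0 : ℝ) 1,
      u i t = g i t + ∑ j, ∫ s in (0 : ℝ)..t, ((t : ℝ) - s) ^ (a i j - 1) *
        (h i j t s * IccExtend zero_le_one (u j) s) := by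
  have hcont : ∀ (u : C(Icc (0 : ℝ) 1, ℝ)) i j, ContinuousOn
      (fun p : ℝ × ℝ => h i j p.1 p.2 * IccExtend zero_le_one u p.2) volterraTriangle :=
    fun u i j => (hh i j).mul (u.continuous.Icc_extend'.comp continuous_snd).continuousOn
  let T : (ι → C(Icc (0 : ℝ) 1, ℝ)) → ι → C(Icc (0 : ℝ) 1, ℝ) := fun u i =>
    ⟨fun t => g i t + ∑ j, ∫ s in (0 : ℝ)..t, ((t : ℝ) - s) ^ (a i j - 1) *
        (h i j t s * IccExtend zero_le_one (u j) s),
      ((hg i).comp_continuous continuous_subtype_val Subtype.prop).add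
        (continuous_finsetSum _ fun j _ =>
          (continuousOn_integral_abel (f := fun t s => h i j t s * IccExtend zero_le_one (u j) s)
            (ha i j) (hcont (u j) i j)).comp_continuous continuous_subtype_val Subtype.prop)⟩
  set q : ℝ := ∑ i, ∑ j, M i j * ((1 / r) ^ a i j * Real.Gamma (a i j)) with hq
  have hterm : ∀ i j, 0 ≤ M i j * ((1 / r) ^ a i j * Real.Gamma (a i j)) := fun i j =>
    mul_nonneg (hM i j) (mul_nonneg (by positivity) (Real.Gamma_pos_of_pos (ha i j)).le)
  have hq0 : 0 ≤ q := Finset.sum_nonneg fun i _ => Finset.sum_nonneg fun j _ => hterm i j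
  have hT : ContractingWith ⟨q, hq0⟩ T := by
    refine ⟨by exact_mod_cast hsmall, LipschitzWith.of_dist_le_mul fun u v => ?_⟩
    have hd : 0 ≤ q * dist u v := mul_nonneg hq0 dist_nonneg
    refine (dist_pi_le_iff hd).2 fun i => (ContinuousMap.dist_le hd).2 fun t => ?_
    have huv : ∀ j s, |IccExtend zero_le_one (u j) s - IccExtend zero_le_one (v j) s| ≤
        dist u v := fun j s =>
      ((u j).dist_apply_le_dist (g := v j) _).trans (dist_le_pi_dist u v j)
    have hdiff : T u i t - T v i t = ∑ j, ∫ s in (0 : ℝ)..t, ((t : ℝ) - s) ^ (a i j - 1) *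
        (h i j t s * (IccExtend zero_le_one (u j) s - IccExtend zero_le_one (v j) s)) := by
      simp only [T, ContinuousMap.coe_mk, add_sub_add_left_eq_sub, ← Finset.sum_sub_distrib]
      refine Finset.sum_congr rfl fun j _ => ?_
      rw [← intervalIntegral.integral_sub
        (intervalIntegrable_abel (f := fun t s => h i j t s * IccExtend zero_le_one (u j) s)
          (ha i j) (hcont (u j) i j) t.2)
        (intervalIntegrable_abel (f := fun t s => h i j t s * IccExtend zero_le_one (v j) s)
          (ha i j) (hcont (v j) i j) t.2)]
      simp only [mul_sub]
    rw [Real.dist_eq, hdiff]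
    calc _ ≤ ∑ j, |∫ s in (0 : ℝ)..t, ((t : ℝ) - s) ^ (a i j - 1) *
          (h i j t s * (IccExtend zero_le_one (u j) s - IccExtend zero_le_one (v j) s))| :=
          Finset.abs_sum_le_sum_abs _ _
      _ ≤ ∑ j, M i j * ((1 / r) ^ a i j * Real.Gamma (a i j)) * dist u v := by
          refine Finset.sum_le_sum fun j _ => ?_
          rw [mul_right_comm]
          refine abs_integral_abel_le (ha i j) hr t.2.1 (mul_nonneg (hM i j) dist_nonneg)
            fun s hs => ?_
          rw [abs_mul, mul_right_comm]
          exact mul_le_mul (hbound i j (t, s) ⟨hs.1, hs.2, t.2.2⟩) (huv j s) (abs_nonneg _)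
            (mul_nonneg (hM i j) (Real.exp_pos _).le)
      _ ≤ q * dist u v := by
          rw [← Finset.sum_mul]
          exact mul_le_mul_of_nonneg_right (Finset.single_le_sum
            (f := fun i => ∑ j, M i j * ((1 / r) ^ a i j * Real.Gamma (a i j)))
            (fun i _ => Finset.sum_nonneg fun j _ => hterm i j) (Finset.mem_univ i)) dist_nonneg
  refine ⟨hT.fixedPoint, fun i t => ?_, fun v hv => hT.fixedPoint_unique ?_⟩
  · exact (DFunLike.congr_fun (congrFun hT.fixedPoint_isFixedPt i) t).symm
  · exact funext fun i => ContinuousMap.ext fun t => (hv i t).symm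

lemma exists_pos_sum_mul_Gamma_lt_one {ι : Type*} [Fintype ι] {a : ι → ι → ℝ}
    (ha : ∀ i j, 0 < a i j) (M : ι → ι → ℝ) :
    ∃ r : ℝ, 0 < r ∧ ∑ i, ∑ j, M i j * ((1 / r) ^ a i j * Real.Gamma (a i j)) < 1 := by
  have hlim : Filter.Tendsto
      (fun r : ℝ => ∑ i, ∑ j, M i j * ((1 / r) ^ a i j * Real.Gamma (a i j)))
      Filter.atTop (nhds (∑ i, ∑ j, M i j * ((0 : ℝ) ^ a i j * Real.Gamma (a i j)))) := by
    refine tendsto_finsetSum _ fun i _ => tendsto_finsetSum _ fun j _ => ?_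
    refine (Filter.Tendsto.mul_const _ ?_).const_mul _
    simp only [one_div]
    exact tendsto_inv_atTop_zero.rpow_const (Or.inr (ha i j).le)
  simp only [Real.zero_rpow (ha _ _).ne', zero_mul, mul_zero, Finset.sum_const_zero] at hlim
  exact ((Filter.eventually_gt_atTop 0).and (hlim.eventually_lt_const one_pos)).exists

/-- Multiplying by `exp (-r t)` moves an exponential weight into the kernel. -/
lemma exp_mul_integral_abel (r c t : ℝ) (f y w : ℝ → ℝ)
    (hw : ∀ s ∈ uIcc 0 t, w s = Real.exp (-(r * s)) * y s) :
    Real.exp (-(r * t)) * ∫ s in (0 : ℝ)..t, (t - s) ^ c * f s * y s =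
      ∫ s in (0 : ℝ)..t, (t - s) ^ c * (Real.exp (-(r * (t - s))) * f s * w s) := by
  rw [← intervalIntegral.integral_const_mul]
  refine intervalIntegral.integral_congr fun s hs => ?_
  have hexp : Real.exp (-(r * t)) = Real.exp (-(r * (t - s))) * Real.exp (-(r * s)) := by
    rw [← Real.exp_add]
    ring_nf
  simp only [hw s hs, hexp]
  ring

/-- **Existence and uniqueness for the system of generalized Abel–Volterra
integral equations.** For `n ≥ 1`, exponents `α i j ∈ (0,1]`, kernels `k i j`
continuous on the triangle `D = {(t,s) : 0 ≤ s ≤ t ≤ 1}` and continuous data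
`g i` on `[0,1]`, there is a unique continuous vector function `y` on `[0,1]`
with `y i t = g i t + ∑ j ∫₀ᵗ (t-s)^(α i j - 1) k i j t s ⬝ y j s ds`. -/
theorem abel_volterra_existence_uniqueness
    (n : ℕ) (hn : 1 ≤ n)
    (α : Fin n → Fin n → ℝ) (hα : ∀ i j, α i j ∈ Set.Ioc (0:ℝ) 1)
    (k : Fin n → Fin n → ℝ → ℝ → ℝ)
    (hk : ∀ i j, ContinuousOn (fun p : ℝ × ℝ => k i j p.1 p.2)
        {p : ℝ × ℝ | 0 ≤ p.2 ∧ p.2 ≤ p.1 ∧ p.1 ≤ 1})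
    (g : Fin n → ℝ → ℝ) (hg : ∀ i, ContinuousOn (g i) (Set.Icc 0 1)) :
    ∃ y : Fin n → ℝ → ℝ,
      ((∀ i, ContinuousOn (y i) (Set.Icc 0 1)) ∧
        ∀ i, ∀ t ∈ Set.Icc (0:ℝ) 1,
          y i t = g i t + ∑ j, ∫ s in (0:ℝ)..t,
            (t - s) ^ (α i j - 1) * k i j t s * y j s) ∧
      ∀ z : Fin n → ℝ → ℝ,
        ((∀ i, ContinuousOn (z i) (Set.Icc 0 1)) ∧
          ∀ i, ∀ t ∈ Set.Icc (0:ℝ) 1,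
            z i t = g i t + ∑ j, ∫ s in (0:ℝ)..t,
              (t - s) ^ (α i j - 1) * k i j t s * z j s) →
        ∀ i, ∀ t ∈ Set.Icc (0:ℝ) 1, z i t = y i t := by
  have ha : ∀ i j, 0 < α i j := fun i j => (hα i j).1
  choose M hM using fun i j => isCompact_volterraTriangle.exists_bound_of_continuousOn (hk i j)
  have hM0 : ∀ i j, 0 ≤ M i j := fun i j =>
    (norm_nonneg _).trans (hM i j (0, 0) ⟨le_rfl, le_rfl, zero_le_one⟩)
  obtain ⟨r, hr, hsmall⟩ := exists_pos_sum_mul_Gamma_lt_one ha M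
  obtain ⟨u, hu, huniq⟩ := exists_unique_abel_of_sum_lt_one ha hr
    (h := fun i j t s => Real.exp (-(r * (t - s))) * k i j t s)
    (fun i j => (Continuous.continuousOn (by fun_prop)).mul (hk i j)) hM0
    (fun i j p hp => by
      rw [abs_mul, abs_of_pos (Real.exp_pos _), mul_comm]
      exact mul_le_mul_of_nonneg_right (hM i j p hp) (Real.exp_pos _).le)
    hsmall (g := fun i t => Real.exp (-(r * t)) * g i t)
    (fun i => (Continuous.continuousOn (by fun_prop)).mul (hg i))
  have hcancel : ∀ x : ℝ, Real.exp (-(r * x)) * Real.exp (r * x) = 1 := fun x => by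
    rw [← Real.exp_add, neg_add_cancel, Real.exp_zero]
  refine ⟨fun i t => Real.exp (r * t) * IccExtend zero_le_one (u i) t, ⟨fun i => ?_, ?_⟩, ?_⟩
  · exact Continuous.continuousOn
      (Continuous.mul (by fun_prop) (u i).continuous.Icc_extend')
  · intro i t ht
    refine mul_left_cancel₀ (Real.exp_pos (-(r * t))).ne' ?_
    rw [← mul_assoc, hcancel, one_mul, mul_add, Finset.mul_sum, IccExtend_of_mem _ _ ht,
      hu i ⟨t, ht⟩]
    congr 1
    refine Finset.sum_congr rfl fun j _ => (exp_mul_integral_abel r _ t _ _ _ fun s _ => ?_).symm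
    rw [← mul_assoc, hcancel, one_mul]
  · rintro z ⟨hz, hzeq⟩ i t ht
    have hv := huniq (fun i => ⟨fun t => Real.exp (-(r * t)) * z i t,
      Continuous.mul (by fun_prop) ((hz i).comp_continuous continuous_subtype_val Subtype.prop)⟩) ?_
    · beta_reduce
      rw [← hv, IccExtend_of_mem _ _ ht, ContinuousMap.coe_mk, ← mul_assoc,
        mul_comm (Real.exp (r * t)), hcancel, one_mul]
    · intro i t
      simp only [ContinuousMap.coe_mk]
      rw [hzeq i t t.2, mul_add, Finset.mul_sum]
      congr 1
      refine Finset.sum_congr rfl fun j _ => exp_mul_integral_abel r _ t _ _ _ fun s hs => ?_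
      rw [uIcc_of_le t.2.1] at hs
      exact IccExtend_of_mem _ _ ⟨hs.1, hs.2.trans t.2.2⟩
end

section
/- Let n ≥ 1 and for i,j = 1,…,n let α_{ij} = a_{ij}/b_{ij} ∈ ℚ ∩ (0,1] with gcd(a_{ij}, b_{ij}) = 1, and let γ be the least common multiple of the denominators {b_{ij}}. Suppose g_i(t) = ḡ_i(t^{1/γ}) and k_{ij}(t,s) = k̄_{ij}(t^{1/γ}, s^{1/γ}), where each ḡ_i is analytic in a neighborhood of 0 and each k̄_{ij} is analytic in a neighborhood of (0,0). Then there exist ε > 0 and, for each i, a power series ∑_{μ=0}^{∞} ȳ_{i,μ} z^μ with radius of convergence greater than ε^{1/γ}, such that the unique continuous solution (y_1,…,y_n) of the system satisfies y_i(t) = ∑_{μ=0}^{∞} ȳ_{i,μ} t^{μ/γ} for all t ∈ [0,ε], the series converging absolutely and uniformly on [0,ε]; equivalently, y_i(t) = Ȳ_i(t^{1/γ}) on [0,ε] where Ȳ_i(z) = ∑_{μ=0}^{∞} ȳ_{i,μ} z^μ is analytic at 0. -/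
open MeasureTheory Set intervalIntegral

/-- On `[0, r]` the function `f` is the sum of a power series whose coefficients satisfy
`∑ μ, |c μ| * r ^ μ ≤ C`. -/
def HasPowerSeriesBound (r C : ℝ) (f : ℝ → ℝ) : Prop :=
  ∃ c : ℕ → ℝ, Summable (fun μ => |c μ| * r ^ μ) ∧ ∑' μ, |c μ| * r ^ μ ≤ C ∧
    ∀ z ∈ Icc 0 r, HasSum (fun μ => c μ * z ^ μ) (f z)

/-- On `[0, r] × [0, r]` the function `kb` is the sum of a family of monomials
`κ x * z ^ P x * w ^ Q x` with `∑ x, |κ x| * r ^ (P x + Q x) ≤ A`. -/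
def HasDoubleSeriesBound (r A : ℝ) (kb : ℝ × ℝ → ℝ) : Prop :=
  ∃ (κ : (Σ m, Finset (Fin m)) → ℝ) (P Q : (Σ m, Finset (Fin m)) → ℕ),
    Summable (fun x => |κ x| * r ^ (P x + Q x)) ∧ ∑' x, |κ x| * r ^ (P x + Q x) ≤ A ∧
    ∀ z ∈ Icc 0 r, ∀ w ∈ Icc 0 r, HasSum (fun x => κ x * z ^ P x * w ^ Q x) (kb (z, w))

theorem HasPowerSeriesBound.of_hasSum {ι : Type*} {r C : ℝ} (hr : 0 ≤ r) {f : ℝ → ℝ}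
    (b : ι → ℝ) (deg : ι → ℕ) (hs : Summable fun x => |b x| * r ^ deg x)
    (hC : ∑' x, |b x| * r ^ deg x ≤ C)
    (hf : ∀ z ∈ Icc 0 r, HasSum (fun x => b x * z ^ deg x) (f z)) :
    HasPowerSeriesBound r C f := by
  have hfib : ∀ (z : ℝ) (μ : ℕ), ∑' x : deg ⁻¹' {μ}, b x * z ^ deg x
      = (∑' x : deg ⁻¹' {μ}, b x) * z ^ μ := by
    intro z μ
    rw [← tsum_mul_right]
    refine tsum_congr fun x => ?_
    have : deg x = μ := x.2
    rw [this]
  have hmaj := hs.hasSum.tsum_fiberwise deg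
  have hle : ∀ μ : ℕ, |∑' x : deg ⁻¹' {μ}, b x| * r ^ μ
      ≤ ∑' x : deg ⁻¹' {μ}, |b x| * r ^ deg x := by
    intro μ
    have h1 : |∑' x : deg ⁻¹' {μ}, b x| * r ^ μ = ‖∑' x : deg ⁻¹' {μ}, b x * r ^ deg x‖ := by
      rw [hfib, Real.norm_eq_abs, abs_mul, abs_of_nonneg (pow_nonneg hr μ)]
    have hn : ∀ x, ‖b x * r ^ deg x‖ = |b x| * r ^ deg x := fun x => by
      rw [Real.norm_eq_abs, abs_mul, abs_of_nonneg (pow_nonneg hr _)]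
    rw [h1]
    refine (norm_tsum_le_tsum_norm ?_).trans_eq (tsum_congr fun x => hn x)
    simp only [hn]
    exact hs.subtype (deg ⁻¹' {μ})
  have hsum : Summable fun μ => |∑' x : deg ⁻¹' {μ}, b x| * r ^ μ :=
    Summable.of_nonneg_of_le (fun μ => by positivity) hle hmaj.summable
  refine ⟨fun μ => ∑' x : deg ⁻¹' {μ}, b x, hsum, ?_, fun z hz => ?_⟩
  · exact ((hsum.tsum_le_tsum hle hmaj.summable).trans_eq hmaj.tsum_eq).trans hC
  · simpa only [hfib] using (hf z hz).tsum_fiberwise deg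

theorem HasPowerSeriesBound.continuousOn {r C : ℝ} {f : ℝ → ℝ}
    (hf : HasPowerSeriesBound r C f) : ContinuousOn f (Icc 0 r) := by
  obtain ⟨c, hs, -, hc⟩ := hf
  have : ContinuousOn (fun z => ∑' μ, c μ * z ^ μ) (Icc 0 r) := by
    refine continuousOn_tsum (fun μ => by fun_prop) hs fun μ z hz => ?_
    rw [Real.norm_eq_abs, abs_mul, abs_of_nonneg (pow_nonneg hz.1 μ)]
    exact mul_le_mul_of_nonneg_left (pow_le_pow_left₀ hz.1 hz.2 μ) (abs_nonneg _)
  exact this.congr fun z hz => (hc z hz).tsum_eq.symm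

theorem HasPowerSeriesBound.nonneg {r C : ℝ} (hr : 0 ≤ r) {f : ℝ → ℝ}
    (hf : HasPowerSeriesBound r C f) : 0 ≤ C := by
  obtain ⟨c, -, hC, -⟩ := hf
  exact (tsum_nonneg fun μ => by positivity).trans hC

theorem HasPowerSeriesBound.abs_le {r C : ℝ} {f : ℝ → ℝ}
    (hf : HasPowerSeriesBound r C f) {z : ℝ} (hz : z ∈ Icc 0 r) : |f z| ≤ C := by
  obtain ⟨c, hs, hC, hc⟩ := hf
  refine le_trans ?_ hC
  rw [← (hc z hz).tsum_eq, ← Real.norm_eq_abs]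
  refine tsum_of_norm_bounded hs.hasSum fun μ => ?_
  rw [Real.norm_eq_abs, abs_mul, abs_of_nonneg (pow_nonneg hz.1 μ)]
  exact mul_le_mul_of_nonneg_left (pow_le_pow_left₀ hz.1 hz.2 μ) (abs_nonneg _)

theorem HasPowerSeriesBound.sum {ι : Type*} [Fintype ι] {r : ℝ} (hr : 0 ≤ r) {C : ι → ℝ}
    {f : ι → ℝ → ℝ} (hf : ∀ j, HasPowerSeriesBound r (C j) (f j)) :
    HasPowerSeriesBound r (∑ j, C j) (fun z => ∑ j, f j z) := by
  choose c hs hC hc using hf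
  have hsum : Summable fun μ => ∑ j, |c j μ| * r ^ μ := summable_sum fun j _ => hs j
  have hle : ∀ μ, |∑ j, c j μ| * r ^ μ ≤ ∑ j, |c j μ| * r ^ μ := fun μ => by
    rw [← Finset.sum_mul]
    exact mul_le_mul_of_nonneg_right (Finset.abs_sum_le_sum_abs _ _) (pow_nonneg hr μ)
  have hs' := Summable.of_nonneg_of_le (fun μ => by positivity) hle hsum
  refine ⟨fun μ => ∑ j, c j μ, hs', ?_, fun z hz => ?_⟩
  · refine (hs'.tsum_le_tsum hle hsum).trans ?_
    rw [Summable.tsum_finsetSum fun j _ => hs j]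
    exact Finset.sum_le_sum fun j _ => hC j
  · simp only [Finset.sum_mul]
    exact hasSum_sum fun j _ => hc j z hz

theorem HasPowerSeriesBound.hasSum {r : ℝ} (hr : 0 ≤ r) {C : ℕ → ℝ} (hCs : Summable C)
    {F : ℕ → ℝ → ℝ} {f : ℝ → ℝ} (hF : ∀ N, HasPowerSeriesBound r (C N) (F N))
    (hf : ∀ z ∈ Icc 0 r, HasSum (fun N => F N z) (f z)) :
    HasPowerSeriesBound r (∑' N, C N) f := by
  choose c hs hC hc using hF
  have hT : Summable fun N => ∑' μ, |c N μ| * r ^ μ :=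
    Summable.of_nonneg_of_le (fun N => tsum_nonneg fun μ => by positivity) hC hCs
  have hsum : Summable fun x : ℕ × ℕ => |c x.1 x.2| * r ^ x.2 :=
    (summable_prod_of_nonneg fun x => by positivity).2 ⟨hs, hT⟩
  refine of_hasSum hr (fun x : ℕ × ℕ => c x.1 x.2) Prod.snd hsum ?_ fun z hz => ?_
  · rw [hsum.tsum_prod]
    exact hT.tsum_le_tsum hC hCs
  · have hz' : Summable fun x : ℕ × ℕ => c x.1 x.2 * z ^ x.2 := by
      refine Summable.of_norm_bounded hsum fun x => ?_
      rw [Real.norm_eq_abs, abs_mul, abs_of_nonneg (pow_nonneg hz.1 _)]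
      exact mul_le_mul_of_nonneg_left (pow_le_pow_left₀ hz.1 hz.2 _) (abs_nonneg _)
    have h1 := hz'.hasSum.prod_fiberwise fun N => hc N z hz
    rw [(hf z hz).unique h1]
    exact hz'.hasSum

theorem HasPowerSeriesBound.mono {r r' C : ℝ} (hr : 0 ≤ r) (hrr : r ≤ r') {f : ℝ → ℝ}
    (hf : HasPowerSeriesBound r' C f) : HasPowerSeriesBound r C f := by
  obtain ⟨c, hs, hC, hc⟩ := hf
  have hle : ∀ μ, |c μ| * r ^ μ ≤ |c μ| * r' ^ μ := fun μ =>
    mul_le_mul_of_nonneg_left (pow_le_pow_left₀ hr hrr μ) (abs_nonneg _)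
  have hs' := Summable.of_nonneg_of_le (fun μ => by positivity) hle hs
  exact ⟨c, hs', (hs'.tsum_le_tsum hle hs).trans hC, fun z hz => hc z ⟨hz.1, hz.2.trans hrr⟩⟩

theorem HasDoubleSeriesBound.mono {r r' A : ℝ} (hr : 0 ≤ r) (hrr : r ≤ r') {kb : ℝ × ℝ → ℝ}
    (hk : HasDoubleSeriesBound r' A kb) : HasDoubleSeriesBound r A kb := by
  obtain ⟨κ, P, Q, hs, hA, hc⟩ := hk
  have hle : ∀ x, |κ x| * r ^ (P x + Q x) ≤ |κ x| * r' ^ (P x + Q x) := fun x =>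
    mul_le_mul_of_nonneg_left (pow_le_pow_left₀ hr hrr _) (abs_nonneg _)
  have hs' := Summable.of_nonneg_of_le (fun x => by positivity) hle hs
  exact ⟨κ, P, Q, hs', (hs'.tsum_le_tsum hle hs).trans hA,
    fun z hz w hw => hc z ⟨hz.1, hz.2.trans hrr⟩ w ⟨hw.1, hw.2.trans hrr⟩⟩

theorem abs_mul_pow_mul_pow_le {a z w r : ℝ} (hz : z ∈ Icc 0 r) (hw : w ∈ Icc 0 r) (p q : ℕ) :
    |a * z ^ p * w ^ q| ≤ |a| * r ^ (p + q) := by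
  rw [abs_mul, abs_mul, abs_of_nonneg (pow_nonneg hz.1 p), abs_of_nonneg (pow_nonneg hw.1 q),
    mul_assoc, pow_add]
  have h1 := pow_le_pow_left₀ hz.1 hz.2 p
  have h2 := pow_le_pow_left₀ hw.1 hw.2 q
  exact mul_le_mul_of_nonneg_left (mul_le_mul h1 h2 (pow_nonneg hw.1 q)
    ((pow_nonneg hz.1 p).trans h1)) (abs_nonneg _)

theorem HasDoubleSeriesBound.abs_le {r A : ℝ} {kb : ℝ × ℝ → ℝ}
    (hk : HasDoubleSeriesBound r A kb) {z w : ℝ} (hz : z ∈ Icc 0 r) (hw : w ∈ Icc 0 r) :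
    |kb (z, w)| ≤ A := by
  obtain ⟨κ, P, Q, hs, hA, hc⟩ := hk
  refine le_trans ?_ hA
  rw [← (hc z hz w hw).tsum_eq, ← Real.norm_eq_abs]
  exact tsum_of_norm_bounded hs.hasSum fun x => abs_mul_pow_mul_pow_le hz hw _ _

theorem HasDoubleSeriesBound.continuousOn {r A : ℝ} {kb : ℝ × ℝ → ℝ}
    (hk : HasDoubleSeriesBound r A kb) : ContinuousOn kb (Icc 0 r ×ˢ Icc 0 r) := by
  obtain ⟨κ, P, Q, hs, -, hc⟩ := hk
  have : ContinuousOn (fun x : ℝ × ℝ => ∑' i, κ i * x.1 ^ P i * x.2 ^ Q i)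
      (Icc 0 r ×ˢ Icc 0 r) :=
    continuousOn_tsum (fun i => by fun_prop) hs fun i x hx =>
      abs_mul_pow_mul_pow_le hx.1 hx.2 _ _
  exact this.congr fun x hx => (hc x.1 hx.1 x.2 hx.2).tsum_eq.symm

theorem AnalyticAt.exists_hasPowerSeriesBound {f : ℝ → ℝ} (hf : AnalyticAt ℝ f 0) :
    ∃ r > 0, ∃ C, HasPowerSeriesBound r C f := by
  obtain ⟨p, R, hp⟩ := hf
  obtain ⟨ρ, hρ0, hρ⟩ := ENNReal.lt_iff_exists_nnreal_btwn.1 hp.r_pos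
  have hs := p.summable_norm_mul_pow (hρ.trans_le hp.r_le)
  have hle : ∀ μ, |p.coeff μ| * (ρ : ℝ) ^ μ ≤ ‖p μ‖ * (ρ : ℝ) ^ μ := fun μ => by
    rw [← Real.norm_eq_abs, p.norm_apply_eq_norm_coef]
  refine ⟨ρ, by exact_mod_cast hρ0, _, p.coeff,
    Summable.of_nonneg_of_le (fun μ => by positivity) hle hs, le_rfl, fun z hz => ?_⟩
  have hzR : z ∈ Metric.eball (0 : ℝ) R := by
    rw [Metric.mem_eball, edist_zero_right]
    refine lt_of_le_of_lt ?_ hρ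
    rw [enorm_le_coe, ← NNReal.coe_le_coe, coe_nnnorm, Real.norm_of_nonneg hz.1]
    exact hz.2
  have := hp.hasSum hzR
  simpa [mul_comm] using this

theorem AnalyticAt.exists_hasDoubleSeriesBound {kb : ℝ × ℝ → ℝ} (hk : AnalyticAt ℝ kb (0, 0)) :
    ∃ r > 0, ∃ A, HasDoubleSeriesBound r A kb := by
  obtain ⟨p, R, hp⟩ := hk
  obtain ⟨ρ, hρ0, hρ⟩ := ENNReal.lt_iff_exists_nnreal_btwn.1 hp.r_pos
  have hρ0' : (0 : ℝ) < ρ := by exact_mod_cast hρ0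
  have hs := p.summable_norm_mul_pow (hρ.trans_le hp.r_le)
  let e (x : Σ m, Finset (Fin m)) : Fin x.1 → ℝ × ℝ :=
    x.2.piecewise (fun _ => ((1 : ℝ), (0 : ℝ))) (fun _ => ((0 : ℝ), (1 : ℝ)))
  have he : ∀ x, |p x.1 (e x)| ≤ ‖p x.1‖ := by
    intro x
    refine ((p x.1).le_opNorm (e x)).trans ?_
    refine mul_le_of_le_one_right (norm_nonneg _) (Finset.prod_le_one (fun _ _ => norm_nonneg _) ?_)
    intro i _
    by_cases hi : i ∈ x.2 <;> simp [e, hi, Prod.norm_def]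
  have hdeg : ∀ x : Σ m, Finset (Fin m), x.2.card + x.2ᶜ.card = x.1 := fun x => by
    rw [Finset.card_add_card_compl, Fintype.card_fin]
  have hexp : ∀ (z w : ℝ) (m : ℕ), (p m fun _ => (z, w)) =
      ∑ s : Finset (Fin m), p m (e ⟨m, s⟩) * z ^ s.card * w ^ sᶜ.card := by
    intro z w m
    have h1 : (fun _ : Fin m => (z, w)) = (fun _ => (z, (0 : ℝ))) + fun _ => ((0 : ℝ), w) := by
      ext <;> simp
    rw [h1, ContinuousMultilinearMap.map_add_univ]
    refine Finset.sum_congr rfl fun s _ => ?_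
    have h2 : s.piecewise (fun _ => (z, (0 : ℝ))) (fun _ => ((0 : ℝ), w)) =
        fun i => (s.piecewise (fun _ => z) (fun _ => w) i : ℝ) • e ⟨m, s⟩ i := by
      funext i
      by_cases hi : i ∈ s <;> simp [e, hi]
    rw [h2, ContinuousMultilinearMap.map_smul_univ, Finset.prod_piecewise]
    simp [Finset.compl_eq_univ_sdiff]
    ring
  have hsum : Summable fun x : Σ m, Finset (Fin m) =>
      |p x.1 (e x)| * ((ρ : ℝ) / 2) ^ (x.2.card + x.2ᶜ.card) := by
    simp only [hdeg]
    refine (summable_sigma_of_nonneg fun x => by positivity).2 ⟨fun m => Summable.of_finite, ?_⟩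
    refine Summable.of_nonneg_of_le (fun m => tsum_nonneg fun s => by positivity) (fun m => ?_) hs
    rw [tsum_fintype]
    refine (Finset.sum_le_sum fun s _ =>
      mul_le_mul_of_nonneg_right (he ⟨m, s⟩) (by positivity)).trans_eq ?_
    change ∑ _s : Finset (Fin m), ‖p m‖ * ((ρ : ℝ) / 2) ^ m = _
    rw [Finset.sum_const, Finset.card_univ, Fintype.card_finset, Fintype.card_fin, nsmul_eq_mul,
      div_pow]
    push_cast
    field_simp
  refine ⟨ρ / 2, by positivity, _, fun x => p x.1 (e x), fun x => x.2.card, fun x => x.2ᶜ.card,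
    hsum, le_rfl, fun z hz w hw => ?_⟩
  have hzw : (z, w) ∈ Metric.eball ((0, 0) : ℝ × ℝ) R := by
    have h0 : ((0, 0) : ℝ × ℝ) = 0 := rfl
    rw [h0, Metric.mem_eball, edist_zero_right]
    refine lt_of_le_of_lt ?_ hρ
    rw [enorm_le_coe, ← NNReal.coe_le_coe, coe_nnnorm, Prod.norm_def, Real.norm_of_nonneg hz.1,
      Real.norm_of_nonneg hw.1]
    exact max_le (hz.2.trans (by linarith)) (hw.2.trans (by linarith))
  have h1 := hp.hasSum hzw
  have h2 : Summable fun x : Σ m, Finset (Fin m) =>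
      p x.1 (e x) * z ^ x.2.card * w ^ x.2ᶜ.card :=
    Summable.of_norm_bounded hsum fun x => abs_mul_pow_mul_pow_le hz hw _ _
  have h3 := h2.hasSum.sigma fun m => hasSum_fintype _
  simp only [← hexp] at h3
  have h4 := h1.unique h3
  simp only [Prod.mk_add_mk, zero_add] at h4
  rw [h4]
  exact h2.hasSum

theorem intervalIntegrable_one_sub_rpow {α : ℝ} (hα : 0 < α) :
    IntervalIntegrable (fun u : ℝ => (1 - u) ^ (α - 1)) volume 0 1 := by
  have h : IntervalIntegrable (fun u : ℝ => u ^ (α - 1)) volume 0 1 :=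
    intervalIntegrable_rpow' (by linarith)
  simpa using (h.comp_sub_left 1).symm

theorem integral_one_sub_rpow {α : ℝ} (hα : 0 < α) :
    ∫ u in (0 : ℝ)..1, (1 - u) ^ (α - 1) = 1 / α := by
  rw [intervalIntegral.integral_comp_sub_left (fun u : ℝ => u ^ (α - 1)) 1,
    integral_rpow (Or.inl (by linarith))]
  simp [hα.ne']

theorem abs_integral_one_sub_rpow_mul_le {α B : ℝ} (hα : 0 < α) {h : ℝ → ℝ}
    (hB : ∀ u ∈ Icc (0 : ℝ) 1, |h u| ≤ B) :
    |∫ u in (0 : ℝ)..1, (1 - u) ^ (α - 1) * h u| ≤ B / α := by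
  have := intervalIntegral.norm_integral_le_of_norm_le (μ := volume) (zero_le_one' ℝ)
    (f := fun u => (1 - u) ^ (α - 1) * h u) (g := fun u => (1 - u) ^ (α - 1) * B)
    (Filter.Eventually.of_forall fun u hu => by
      have h0 : 0 ≤ (1 - u) ^ (α - 1) := Real.rpow_nonneg (by linarith [hu.2]) _
      rw [Real.norm_eq_abs, abs_mul, abs_of_nonneg h0]
      exact mul_le_mul_of_nonneg_left (hB u ⟨hu.1.le, hu.2⟩) h0)
    ((intervalIntegrable_one_sub_rpow hα).mul_const B)
  rwa [intervalIntegral.integral_mul_const, integral_one_sub_rpow hα, Real.norm_eq_abs,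
    one_div_mul_eq_div] at this

/-- The Abel–Volterra integral operator in the variable `z = t ^ ν`, after the substitution
`s = t * u`. -/
noncomputable def abelOp (m : ℕ) (α ν : ℝ) (kb : ℝ × ℝ → ℝ) (f : ℝ → ℝ) (z : ℝ) : ℝ :=
  z ^ m * ∫ u in (0 : ℝ)..1, (1 - u) ^ (α - 1) * (kb (z, z * u ^ ν) * f (z * u ^ ν))

theorem mul_rpow_mem_Icc {r z u ν : ℝ} (hν : 0 ≤ ν) (hz : z ∈ Icc 0 r) (hu : u ∈ Icc (0 : ℝ) 1) :
    z * u ^ ν ∈ Icc 0 r :=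
  ⟨mul_nonneg hz.1 (Real.rpow_nonneg hu.1 _),
    (mul_le_of_le_one_right hz.1 (Real.rpow_le_one hu.1 hu.2 hν)).trans hz.2⟩

theorem intervalIntegrable_abelOp {r A α ν z : ℝ} {kb : ℝ × ℝ → ℝ} {f : ℝ → ℝ} (hα : 0 < α)
    (hν : 0 ≤ ν) (hk : HasDoubleSeriesBound r A kb) (hf : ContinuousOn f (Icc 0 r))
    (hz : z ∈ Icc 0 r) :
    IntervalIntegrable (fun u => (1 - u) ^ (α - 1) * (kb (z, z * u ^ ν) * f (z * u ^ ν)))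
      volume 0 1 := by
  refine (intervalIntegrable_one_sub_rpow hα).mul_continuousOn ?_
  rw [uIcc_of_le zero_le_one]
  have hφ : Continuous fun u : ℝ => z * u ^ ν := continuous_const.mul (Real.continuous_rpow_const hν)
  have hmaps : MapsTo (fun u : ℝ => z * u ^ ν) (Icc 0 1) (Icc 0 r) := fun u hu =>
    mul_rpow_mem_Icc hν hz hu
  refine ContinuousOn.mul ?_ (hf.comp hφ.continuousOn hmaps)
  exact hk.continuousOn.comp (f := fun u : ℝ => (z, z * u ^ ν))
    (continuous_const.prodMk hφ).continuousOn fun u hu => ⟨hz, hmaps hu⟩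

theorem abelOp_sub {m : ℕ} {r A α ν z : ℝ} {kb : ℝ × ℝ → ℝ} {f h : ℝ → ℝ} (hα : 0 < α)
    (hν : 0 ≤ ν) (hk : HasDoubleSeriesBound r A kb) (hf : ContinuousOn f (Icc 0 r))
    (hh : ContinuousOn h (Icc 0 r)) (hz : z ∈ Icc 0 r) :
    abelOp m α ν kb (fun z => f z - h z) z = abelOp m α ν kb f z - abelOp m α ν kb h z := by
  unfold abelOp
  rw [← mul_sub, ← intervalIntegral.integral_sub (intervalIntegrable_abelOp hα hν hk hf hz)
    (intervalIntegrable_abelOp hα hν hk hh hz)]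
  simp only [mul_sub]

theorem abs_abelOp_le {m : ℕ} {r A α ν z M : ℝ} {kb : ℝ × ℝ → ℝ} {f : ℝ → ℝ} (hα : 0 < α)
    (hν : 0 ≤ ν) (hk : HasDoubleSeriesBound r A kb) (hf : ∀ z ∈ Icc 0 r, |f z| ≤ M)
    (hz : z ∈ Icc 0 r) : |abelOp m α ν kb f z| ≤ r ^ m * (A / α) * M := by
  have hb : |∫ u in (0 : ℝ)..1, (1 - u) ^ (α - 1) * (kb (z, z * u ^ ν) * f (z * u ^ ν))|
      ≤ A * M / α := by
    refine abs_integral_one_sub_rpow_mul_le hα fun u hu => ?_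
    have hu' := mul_rpow_mem_Icc hν hz hu
    have h1 := hk.abs_le hz hu'
    rw [abs_mul]
    exact mul_le_mul h1 (hf _ hu') (abs_nonneg _) ((abs_nonneg _).trans h1)
  rw [abelOp, abs_mul, abs_of_nonneg (pow_nonneg hz.1 m)]
  calc _ ≤ r ^ m * (A * M / α) :=
        mul_le_mul (pow_le_pow_left₀ hz.1 hz.2 m) hb (abs_nonneg _)
          (pow_nonneg (hz.1.trans hz.2) m)
    _ = _ := by ring

theorem HasPowerSeriesBound.abelOp {m : ℕ} {r A C α ν : ℝ} {kb : ℝ × ℝ → ℝ} {f : ℝ → ℝ}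
    (hr : 0 ≤ r) (hα : 0 < α) (hν : 0 ≤ ν) (hk : HasDoubleSeriesBound r A kb)
    (hf : HasPowerSeriesBound r C f) :
    HasPowerSeriesBound r (r ^ m * (A / α) * C) (abelOp m α ν kb f) := by
  obtain ⟨κ, P, Q, hκs, hκA, hκ⟩ := hk
  obtain ⟨c, hcs, hcC, hc⟩ := hf
  let β : ℕ → ℝ := fun l => ∫ u in (0 : ℝ)..1, (1 - u) ^ (α - 1) * (u ^ ν) ^ l
  have hβ : ∀ l, |β l| ≤ 1 / α := fun l => by
    refine abs_integral_one_sub_rpow_mul_le hα fun u hu => ?_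
    rw [abs_of_nonneg (pow_nonneg (Real.rpow_nonneg hu.1 _) _)]
    exact pow_le_one₀ (Real.rpow_nonneg hu.1 _) (Real.rpow_le_one hu.1 hu.2 hν)
  have hprod : Summable fun x : (Σ m, Finset (Fin m)) × ℕ =>
      |κ x.1| * r ^ (P x.1 + Q x.1) * (|c x.2| * r ^ x.2) :=
    hκs.mul_of_nonneg hcs (fun x => by positivity) fun μ => by positivity
  have hle : ∀ x : (Σ m, Finset (Fin m)) × ℕ,
      |κ x.1 * c x.2 * β (Q x.1 + x.2)| * r ^ (m + P x.1 + Q x.1 + x.2) ≤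
        r ^ m * (1 / α) * (|κ x.1| * r ^ (P x.1 + Q x.1) * (|c x.2| * r ^ x.2)) := by
    intro x
    rw [abs_mul, abs_mul]
    calc _ = |β (Q x.1 + x.2)| *
          (r ^ m * (|κ x.1| * r ^ (P x.1 + Q x.1) * (|c x.2| * r ^ x.2))) := by ring
      _ ≤ 1 / α * (r ^ m * (|κ x.1| * r ^ (P x.1 + Q x.1) * (|c x.2| * r ^ x.2))) :=
        mul_le_mul_of_nonneg_right (hβ _) (by positivity)
      _ = _ := by ring
  have hs := Summable.of_nonneg_of_le (fun x => by positivity) hle (hprod.mul_left _)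
  refine of_hasSum hr (fun x : (Σ m, Finset (Fin m)) × ℕ => κ x.1 * c x.2 * β (Q x.1 + x.2))
    (fun x => m + P x.1 + Q x.1 + x.2) hs ?_ fun z hz => ?_
  · refine (hs.tsum_le_tsum hle (hprod.mul_left _)).trans ?_
    rw [tsum_mul_left, ← hκs.tsum_mul_tsum hcs hprod]
    have h0 : 0 ≤ ∑' μ, |c μ| * r ^ μ := tsum_nonneg fun μ => by positivity
    have h1 : 0 ≤ ∑' x, |κ x| * r ^ (P x + Q x) := tsum_nonneg fun x => by positivity
    calc _ ≤ r ^ m * (1 / α) * (A * C) :=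
          mul_le_mul_of_nonneg_left (mul_le_mul hκA hcC h0 (h1.trans hκA)) (by positivity)
      _ = _ := by ring
  · have key := intervalIntegral.hasSum_integral_of_dominated_convergence (μ := volume)
      (a := 0) (b := 1)
      (F := fun (x : (Σ m, Finset (Fin m)) × ℕ) u => (1 - u) ^ (α - 1) *
        (κ x.1 * z ^ P x.1 * (z * u ^ ν) ^ Q x.1 * (c x.2 * (z * u ^ ν) ^ x.2)))
      (f := fun u => (1 - u) ^ (α - 1) * (kb (z, z * u ^ ν) * f (z * u ^ ν)))
      (fun x u => (1 - u) ^ (α - 1) *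
        (|κ x.1| * r ^ (P x.1 + Q x.1) * (|c x.2| * r ^ x.2)))
      (fun x => Measurable.aestronglyMeasurable (by fun_prop)) ?_ ?_ ?_ ?_
    · refine (congrArg (HasSum · _) (funext fun x => ?_)).mpr (key.mul_left (z ^ m))
      have : ∀ u : ℝ, (1 - u) ^ (α - 1) *
          (κ x.1 * z ^ P x.1 * (z * u ^ ν) ^ Q x.1 * (c x.2 * (z * u ^ ν) ^ x.2)) =
          (κ x.1 * c x.2 * z ^ (P x.1 + Q x.1 + x.2)) *
            ((1 - u) ^ (α - 1) * (u ^ ν) ^ (Q x.1 + x.2)) := fun u => by ring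
      simp only [this]
      rw [intervalIntegral.integral_const_mul]
      ring
    · intro x
      refine Filter.Eventually.of_forall fun u hu => ?_
      rw [uIoc_of_le zero_le_one] at hu
      have h0 : 0 ≤ (1 - u) ^ (α - 1) := Real.rpow_nonneg (by linarith [hu.2]) _
      have hu' := mul_rpow_mem_Icc hν hz ⟨hu.1.le, hu.2⟩
      rw [Real.norm_eq_abs, abs_mul, abs_of_nonneg h0, abs_mul]
      refine mul_le_mul_of_nonneg_left (mul_le_mul (abs_mul_pow_mul_pow_le hz hu' _ _) ?_
        (abs_nonneg _) (by positivity)) h0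
      rw [abs_mul, abs_of_nonneg (pow_nonneg hu'.1 _)]
      exact mul_le_mul_of_nonneg_left (pow_le_pow_left₀ hu'.1 hu'.2 _) (abs_nonneg _)
    · exact Filter.Eventually.of_forall fun u _ => hprod.mul_left _
    · simp only [tsum_mul_left]
      exact (intervalIntegrable_one_sub_rpow hα).mul_const _
    · refine Filter.Eventually.of_forall fun u hu => ?_
      rw [uIoc_of_le zero_le_one] at hu
      have hu' := mul_rpow_mem_Icc hν hz ⟨hu.1.le, hu.2⟩
      refine HasSum.mul_left _ ((hκ z hz _ hu').mul (hc _ hu') ?_)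
      refine Summable.of_norm_bounded hprod fun x => ?_
      rw [Real.norm_eq_abs, abs_mul]
      refine mul_le_mul (abs_mul_pow_mul_pow_le hz hu' _ _) ?_ (abs_nonneg _) (by positivity)
      rw [abs_mul, abs_of_nonneg (pow_nonneg hu'.1 _)]
      exact mul_le_mul_of_nonneg_left (pow_le_pow_left₀ hu'.1 hu'.2 _) (abs_nonneg _)

/-- Continuous solutions of the transformed system are sums of power series as soon as `r` is so
small that the system is a contraction with constant `1 / 2`. -/
theorem hasPowerSeriesBound_of_abelOp_system {ι : Type*} [Fintype ι] {r ν C M : ℝ} (hr : 0 ≤ r)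
    (hν : 0 ≤ ν) {m : ι → ι → ℕ} {α A : ι → ι → ℝ} (hα : ∀ i j, 0 < α i j)
    {gb : ι → ℝ → ℝ} {kb : ι → ι → ℝ × ℝ → ℝ} {Y : ι → ℝ → ℝ}
    (hg : ∀ i, HasPowerSeriesBound r C (gb i))
    (hk : ∀ i j, HasDoubleSeriesBound r (A i j) (kb i j))
    (hcontr : ∀ i, ∑ j, r ^ m i j * (A i j / α i j) ≤ 1 / 2)
    (hYc : ∀ i, ContinuousOn (Y i) (Icc 0 r)) (hYM : ∀ i, ∀ z ∈ Icc 0 r, |Y i z| ≤ M)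
    (hY : ∀ i, ∀ z ∈ Icc 0 r,
      Y i z = gb i z + ∑ j, abelOp (m i j) (α i j) ν (kb i j) (Y j) z) (i : ι) :
    ∃ C', HasPowerSeriesBound r C' (Y i) := by
  have hC0 : 0 ≤ C := (hg i).nonneg hr
  have hM0 : 0 ≤ M := (abs_nonneg _).trans (hYM i 0 ⟨le_rfl, hr⟩)
  have hhalf : ∀ {B : ℝ}, 0 ≤ B → ∀ i, ∑ j, r ^ m i j * (A i j / α i j) * B ≤ B / 2 :=
    fun {B} hB i => by
      rw [← Finset.sum_mul]
      linarith [mul_le_mul_of_nonneg_right (hcontr i) hB]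
  let F : ℕ → ι → ℝ → ℝ := fun N => Nat.rec gb
    (fun _ f i z => ∑ j, abelOp (m i j) (α i j) ν (kb i j) (f j) z) N
  have hFsucc : ∀ N i z, F (N + 1) i z = ∑ j, abelOp (m i j) (α i j) ν (kb i j) (F N j) z :=
    fun N i z => rfl
  have hF : ∀ N i, HasPowerSeriesBound r (C / 2 ^ N) (F N i) := by
    intro N
    induction N with
    | zero => intro i; simpa [F] using hg i
    | succ N ih =>
      intro i
      have h1 := HasPowerSeriesBound.sum hr fun j =>
        HasPowerSeriesBound.abelOp (m := m i j) hr (hα i j) hν (hk i j) (ih j)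
      obtain ⟨c, hs, hC, hc⟩ := h1
      refine ⟨c, hs, (hC.trans (hhalf (by positivity) i)).trans_eq ?_, hc⟩
      rw [pow_succ, div_div]
  let D : ℕ → ι → ℝ → ℝ := fun N i z => Y i z - ∑ k ∈ Finset.range N, F k i z
  have hDsucc : ∀ N i z, D (N + 1) i z = D N i z - F N i z := fun N i z => by
    simp only [D, Finset.sum_range_succ]; ring
  have hDc : ∀ N i, ContinuousOn (D N i) (Icc 0 r) := fun N i =>
    (hYc i).sub (continuousOn_finsetSum _ fun k _ => (hF k i).continuousOn)
  have hDK : ∀ N i, ∀ z ∈ Icc 0 r,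
      D (N + 1) i z = ∑ j, abelOp (m i j) (α i j) ν (kb i j) (D N j) z := by
    intro N
    induction N with
    | zero =>
      intro i z hz
      have h0 : D 0 = Y := by funext i z; simp [D]
      rw [hDsucc, h0, hY i z hz]
      simp [F]
    | succ N ih =>
      intro i z hz
      rw [hDsucc, ih i z hz, hFsucc, ← Finset.sum_sub_distrib]
      refine Finset.sum_congr rfl fun j _ => ?_
      rw [← abelOp_sub (hα i j) hν (hk i j) (hDc N j) (hF N j).continuousOn hz]
      congr 1
      funext w
      exact (hDsucc N j w).symm
  have hDM : ∀ N i, ∀ z ∈ Icc 0 r, |D N i z| ≤ M / 2 ^ N := by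
    intro N
    induction N with
    | zero => intro i z hz; simpa [D] using hYM i z hz
    | succ N ih =>
      intro i z hz
      rw [hDK N i z hz]
      refine (Finset.abs_sum_le_sum_abs _ _).trans ?_
      refine (Finset.sum_le_sum fun j _ =>
        abs_abelOp_le (hα i j) hν (hk i j) (ih j) hz).trans ?_
      refine (hhalf (by positivity) i).trans_eq ?_
      rw [pow_succ, div_div]
  have hgeom : ∀ B : ℝ, Summable fun N : ℕ => B / 2 ^ N := fun B => by
    simpa [div_eq_mul_inv, inv_pow] using summable_geometric_two.mul_left B
  refine ⟨_, HasPowerSeriesBound.hasSum hr (hgeom C) (fun N => hF N i) fun z hz => ?_⟩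
  have hsF : Summable fun N => F N i z :=
    Summable.of_norm_bounded (hgeom C) fun N => (hF N i).abs_le hz
  rw [hsF.hasSum_iff_tendsto_nat]
  have hD0 : Filter.Tendsto (fun N => D N i z) Filter.atTop (nhds 0) :=
    squeeze_zero_norm (fun N => hDM N i z hz) (hgeom M).tendsto_atTop_zero
  simpa [D] using (hD0.const_sub (Y i z))

theorem integral_eq_abelOp {α : ℝ} {γ m : ℕ} (hγ : γ ≠ 0) (hm : (m : ℝ) = α * γ) (hm0 : m ≠ 0)
    (kb : ℝ × ℝ → ℝ) (y : ℝ → ℝ) {z : ℝ} (hz : 0 ≤ z) :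
    ∫ s in (0 : ℝ)..z ^ γ, (z ^ γ - s) ^ (α - 1) * kb (z, s ^ (1 / (γ : ℝ))) * y s =
      abelOp m α (1 / γ) kb (fun w => y (w ^ γ)) z := by
  rcases hz.eq_or_lt with rfl | hz'
  · simp [abelOp, hγ, hm0]
  have ht : 0 < z ^ γ := pow_pos hz' γ
  have hsub := intervalIntegral.smul_integral_comp_mul_left (a := 0) (b := 1)
    (fun s => (z ^ γ - s) ^ (α - 1) * kb (z, s ^ (1 / (γ : ℝ))) * y s) (z ^ γ)
  rw [mul_zero, mul_one] at hsub
  have hpow : z ^ γ * (z ^ γ) ^ (α - 1) = z ^ m := by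
    rw [← Real.rpow_one_add' ht.le (by
      intro h
      have : α = 0 := by linarith
      rw [this, zero_mul] at hm
      exact hm0 (by exact_mod_cast hm)), ← Real.rpow_natCast z γ, ← Real.rpow_mul hz,
      ← Real.rpow_natCast z m, hm]
    ring_nf
  rw [← hsub, smul_eq_mul, abelOp, ← hpow, mul_assoc,
    ← intervalIntegral.integral_const_mul ((z ^ γ) ^ (α - 1))]
  congr 1
  refine intervalIntegral.integral_congr fun u hu => ?_
  rw [uIcc_of_le zero_le_one] at hu
  have h1 : (z ^ γ - z ^ γ * u) ^ (α - 1) = (z ^ γ) ^ (α - 1) * (1 - u) ^ (α - 1) := by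
    rw [← Real.mul_rpow ht.le (by linarith [hu.2]), mul_sub, mul_one]
  have h2 : (z ^ γ * u) ^ (1 / (γ : ℝ)) = z * u ^ (1 / (γ : ℝ)) := by
    rw [Real.mul_rpow ht.le hu.1, one_div, Real.pow_rpow_inv_natCast hz hγ]
  have h3 : (z * u ^ (1 / (γ : ℝ))) ^ γ = z ^ γ * u := by
    rw [mul_pow, one_div, Real.rpow_inv_natCast_pow hu.1 hγ]
  simp only [h1, h2, h3]
  ring

theorem HasPowerSeriesBound.mono_right {r C C' : ℝ} {f : ℝ → ℝ}
    (hf : HasPowerSeriesBound r C f) (hC : C ≤ C') : HasPowerSeriesBound r C' f := by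
  obtain ⟨c, hs, hc, hf⟩ := hf
  exact ⟨c, hs, hc.trans hC, hf⟩

theorem summable_abs_mul_pow_of_lt {c : ℕ → ℝ} {r z : ℝ}
    (hs : Summable fun μ => |c μ| * r ^ μ) (hz : |z| < r) :
    Summable fun μ => |c μ| * |z| ^ μ :=
  Summable.of_nonneg_of_le (fun μ => by positivity) (fun μ =>
    mul_le_mul_of_nonneg_left (pow_le_pow_left₀ (abs_nonneg z) hz.le μ) (abs_nonneg _)) hs

theorem analyticAt_tsum_mul_pow {c : ℕ → ℝ} {r : ℝ} (hr : 0 < r)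
    (hs : Summable fun μ => |c μ| * r ^ μ) : AnalyticAt ℝ (fun z => ∑' μ, c μ * z ^ μ) 0 := by
  refine ⟨FormalMultilinearSeries.ofScalars ℝ c, hasFPowerSeriesAt_iff.2 ?_⟩
  filter_upwards [Metric.ball_mem_nhds (0 : ℝ) hr] with z hz
  rw [mem_ball_zero_iff, Real.norm_eq_abs] at hz
  have hsum : Summable fun μ => c μ * z ^ μ :=
    Summable.of_norm (by simpa [abs_mul] using summable_abs_mul_pow_of_lt hs hz)
  simpa [FormalMultilinearSeries.coeff_ofScalars, mul_comm] using hsum.hasSum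

/-- **Smoothness of the solutions of a system of generalized Abel–Volterra
integral equations.** If `α i j = a i j / b i j ∈ ℚ ∩ (0,1]` with
`gcd (a i j) (b i j) = 1`, `γ` is the least common multiple of the
denominators, `g i t = ḡ i (t^(1/γ))` and `k i j t s = k̄ i j (t^(1/γ), s^(1/γ))`
with `ḡ i` analytic at `0` and `k̄ i j` analytic at `(0,0)`, then the unique
continuous solution satisfies, on some `[0,ε]` with `ε > 0`,
`y i t = ∑ μ, c i μ • t^(μ/γ)`, where the power series `∑ μ, c i μ • z^μ`
has radius of convergence greater than `ε^(1/γ)` (so the series converges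
absolutely and uniformly on `[0,ε]`). -/
theorem abel_volterra_smoothness
    (n : ℕ) (hn : 1 ≤ n)
    (a b : Fin n → Fin n → ℕ) (hb : ∀ i j, 0 < b i j)
    (hgcd : ∀ i j, Nat.gcd (a i j) (b i j) = 1)
    (α : Fin n → Fin n → ℝ) (hα : ∀ i j, α i j = (a i j : ℝ) / (b i j : ℝ))
    (hα01 : ∀ i j, α i j ∈ Set.Ioc (0:ℝ) 1)
    (γ : ℕ) (hγ : γ = (Finset.univ : Finset (Fin n × Fin n)).lcm (fun p => b p.1 p.2))
    (g : Fin n → ℝ → ℝ) (k : Fin n → Fin n → ℝ → ℝ → ℝ)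
    (gbar : Fin n → ℝ → ℝ) (kbar : Fin n → Fin n → ℝ × ℝ → ℝ)
    (hganal : ∀ i, AnalyticAt ℝ (gbar i) 0)
    (hkanal : ∀ i j, AnalyticAt ℝ (kbar i j) (0, 0))
    (hgrep : ∀ i, ∀ t ∈ Set.Icc (0:ℝ) 1, g i t = gbar i (t ^ (1/(γ:ℝ))))
    (hkrep : ∀ i j, ∀ t ∈ Set.Icc (0:ℝ) 1, ∀ s ∈ Set.Icc (0:ℝ) t,
        k i j t s = kbar i j (t ^ (1/(γ:ℝ)), s ^ (1/(γ:ℝ))))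
    (y : Fin n → ℝ → ℝ)
    (hycont : ∀ i, ContinuousOn (y i) (Set.Icc 0 1))
    (hysol : ∀ i, ∀ t ∈ Set.Icc (0:ℝ) 1,
        y i t = g i t + ∑ j, ∫ s in (0:ℝ)..t,
          (t - s) ^ (α i j - 1) * k i j t s * y j s) :
    ∃ ε > 0, ∃ c : Fin n → ℕ → ℝ,
      -- the power series `∑ μ, c i μ • z^μ` has radius of convergence
      -- greater than `ε^(1/γ)` (hence absolute and uniform convergence on `[0,ε]`)
      (∀ i, ∃ R : ℝ, ε ^ (1/(γ:ℝ)) < R ∧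
        ∀ z : ℝ, |z| < R → Summable (fun μ : ℕ => |c i μ| * |z| ^ μ)) ∧
      -- series representation of the solution on `[0,ε]`
      (∀ i, ∀ t ∈ Set.Icc (0:ℝ) ε,
        HasSum (fun μ : ℕ => c i μ * t ^ ((μ:ℝ)/(γ:ℝ))) (y i t)) ∧
      -- equivalently, `y i t = Ȳ i (t^(1/γ))` with `Ȳ i` analytic at `0`
      (∃ Ybar : Fin n → ℝ → ℝ, (∀ i, AnalyticAt ℝ (Ybar i) 0) ∧
        ∀ i, ∀ t ∈ Set.Icc (0:ℝ) ε, y i t = Ybar i (t ^ (1/(γ:ℝ)))) := by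
  have hb_dvd : ∀ i j, b i j ∣ γ := fun i j => by
    rw [hγ]
    exact Finset.dvd_lcm (f := fun p : Fin n × Fin n => b p.1 p.2) (Finset.mem_univ (i, j))
  have hγ0 : γ ≠ 0 := by
    rw [hγ, Ne, Finset.lcm_eq_zero_iff]
    rintro ⟨p, -, hp⟩
    exact (hb p.1 p.2).ne' hp
  have hα0 : ∀ i j, 0 < α i j := fun i j => (hα01 i j).1
  have hm_ex : ∀ i j, ∃ m : ℕ, (m : ℝ) = α i j * γ := fun i j => by
    obtain ⟨q, hq⟩ := hb_dvd i j
    refine ⟨a i j * q, ?_⟩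
    have : (b i j : ℝ) ≠ 0 := by exact_mod_cast (hb i j).ne'
    rw [hα, hq]
    push_cast
    field_simp
  choose m hm using hm_ex
  have hm0 : ∀ i j, m i j ≠ 0 := fun i j h => by
    have h1 := hm i j
    rw [h, Nat.cast_zero] at h1
    exact (mul_pos (hα0 i j) (by exact_mod_cast Nat.pos_of_ne_zero hγ0)).ne h1
  choose ρ hρ0 C hC using fun i => (hganal i).exists_hasPowerSeriesBound
  choose σ hσ0 A hA using fun i j => (hkanal i j).exists_hasDoubleSeriesBound
  have hsmall : ∀ {x : ℝ}, 0 < x → ∀ᶠ r in nhdsWithin (0 : ℝ) (Ioi 0), r ≤ x := fun hx =>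
    Filter.Eventually.filter_mono nhdsWithin_le_nhds (Iic_mem_nhds hx)
  have hcontr : ∀ i, ∀ᶠ r in nhdsWithin (0 : ℝ) (Ioi 0),
      ∑ j, r ^ m i j * (A i j / α i j) ≤ 1 / 2 := fun i => by
    have hcont : Continuous fun r : ℝ => ∑ j, r ^ m i j * (A i j / α i j) := by fun_prop
    have h0 : ∑ j, (0 : ℝ) ^ m i j * (A i j / α i j) < 1 / 2 := by simp [hm0]
    exact ((hcont.tendsto 0).eventually_le_const h0).filter_mono nhdsWithin_le_nhds
  obtain ⟨r, hr0, hr1, hrρ, hrσ, hrc⟩ := (Filter.Eventually.and (self_mem_nhdsWithin (a := (0 : ℝ)) (s := Ioi 0))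
    ((hsmall one_pos).and ((Filter.eventually_all.2 fun i => hsmall (hρ0 i)).and
      ((Filter.eventually_all.2 fun i => Filter.eventually_all.2 fun j => hsmall (hσ0 i j)).and
        (Filter.eventually_all.2 hcontr))))).exists
  replace hr0 : 0 < r := hr0
  have hpow_mem : ∀ z ∈ Icc 0 r, z ^ γ ∈ Icc (0 : ℝ) 1 := fun z hz =>
    ⟨pow_nonneg hz.1 γ, pow_le_one₀ hz.1 (hz.2.trans hr1)⟩
  have hM_ex : ∀ i, ∃ M, ∀ t ∈ Icc (0 : ℝ) 1, |y i t| ≤ M := fun i =>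
    isCompact_Icc.exists_bound_of_continuousOn (hycont i)
  choose M hM using hM_ex
  have hM0 : ∀ i, 0 ≤ M i := fun i => (abs_nonneg _).trans (hM i 0 ⟨le_rfl, zero_le_one⟩)
  have hYeq : ∀ i, ∀ z ∈ Icc 0 r, y i (z ^ γ) = gbar i z +
      ∑ j, abelOp (m i j) (α i j) (1 / γ) (kbar i j) (fun w => y j (w ^ γ)) z := by
    intro i z hz
    have ht := hpow_mem z hz
    have hroot : (z ^ γ) ^ (1 / (γ : ℝ)) = z := by
      rw [one_div, Real.pow_rpow_inv_natCast hz.1 hγ0]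
    rw [hysol i _ ht, hgrep i _ ht, hroot]
    congr 1
    refine Finset.sum_congr rfl fun j _ => ?_
    rw [← integral_eq_abelOp hγ0 (hm i j) (hm0 i j) _ _ hz.1]
    refine intervalIntegral.integral_congr fun s hs => ?_
    rw [uIcc_of_le ht.1] at hs
    simp only [hkrep i j _ ht s hs, hroot]
  have hser := hasPowerSeriesBound_of_abelOp_system (C := ∑ i, C i) (M := ∑ i, M i)
    (Y := fun i z => y i (z ^ γ)) hr0.le (by positivity) hα0
    (fun i => ((hC i).mono hr0.le (hrρ i)).mono_right
      (Finset.single_le_sum (fun i _ => (hC i).nonneg (hρ0 i).le) (Finset.mem_univ i)))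
    (fun i j => (hA i j).mono hr0.le (hrσ i j)) hrc
    (fun i => (hycont i).comp (by fun_prop) hpow_mem)
    (fun i z hz => (hM i _ (hpow_mem z hz)).trans
      (Finset.single_le_sum (fun i _ => hM0 i) (Finset.mem_univ i))) hYeq
  choose B c hs _ hc using hser
  have hεroot : ((r / 2) ^ γ) ^ (1 / (γ : ℝ)) = r / 2 := by
    rw [one_div, Real.pow_rpow_inv_natCast (by positivity) hγ0]
  have hrep : ∀ i, ∀ t ∈ Icc (0 : ℝ) ((r / 2) ^ γ),
      HasSum (fun μ => c i μ * (t ^ (1 / (γ : ℝ))) ^ μ) (y i t) := by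
    intro i t ht
    have hz : t ^ (1 / (γ : ℝ)) ∈ Icc 0 r := by
      refine ⟨Real.rpow_nonneg ht.1 _, ?_⟩
      have := Real.rpow_le_rpow ht.1 ht.2 (z := 1 / (γ : ℝ)) (by positivity)
      rw [hεroot] at this
      linarith
    have := hc i _ hz
    dsimp only at this
    rwa [one_div, Real.rpow_inv_natCast_pow ht.1 hγ0, ← one_div] at this
  refine ⟨(r / 2) ^ γ, by positivity, c, fun i => ⟨r, ?_, fun z hz => ?_⟩, fun i t ht => ?_,
    fun i z => ∑' μ, c i μ * z ^ μ, fun i => analyticAt_tsum_mul_pow hr0 (hs i),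
    fun i t ht => (hrep i t ht).tsum_eq.symm⟩
  · rw [hεroot]
    linarith
  · exact summable_abs_mul_pow_of_lt (hs i) hz
  · refine (congrArg (HasSum · _) (funext fun μ => ?_)).mpr (hrep i t ht)
    rw [← Real.rpow_natCast, ← Real.rpow_mul ht.1, one_div_mul_eq_div]
end

section
/- Let n ≥ 1, σ ∈ (0,1), and for i,j = 1,…,n let α_{ij} ∈ (0,1], let k_{ij} be continuous on [0,1]×[0,1], and let g_i be continuous on [0,1]. Let (y_1,…,y_n) be the unique continuous solution of y_i(t) = g_i(t) + ∑_{j=1}^{n} ∫₀ᵗ (t−s)^{α_{ij}−1} k_{ij}(t,s) y_j(s) ds on [0,1]. Suppose for each N, continuous functions y_{N,1},…,y_{N,n} and H_{N,1},…,H_{N,n} on [0,1] satisfy the perturbed equations y_{N,i}(t) = H_{N,i}(t) + (Π_{N,σ}g_i)(t) + ∑_{j=1}^{n} ∫₀ᵗ (t−s)^{α_{ij}−1} (Π_{N,σ}k_{ij})(t,s) y_{N,j}(s) ds for all t ∈ [0,1]. Then there exists a constant C > 0 independent of N such that for every N and every i: ‖y_i − y_{N,i}‖_∞ ≤ C ( max_l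 ‖H_{N,l}‖_∞ + max_l ‖g_l − Π_{N,σ}g_l‖_∞ + max_{l,j} ‖k_{lj} − Π_{N,σ}k_{lj}‖_∞ · ( max_j ‖y_j‖_∞ + max_j ‖y_j − y_{N,j}‖_∞ ) ). -/
open MeasureTheory Set

/-- `P` is the orthogonal projection `Π_{N,σ} u` of `u ∈ L²([0,1])` onto the
Müntz space `M_{N,σ} = span{t^(iσ) : 0 ≤ i ≤ N}`. -/
def IsMuntzProjection (σ : ℝ) (N : ℕ) (u P : ℝ → ℝ) : Prop :=
  (∃ c : Fin (N+1) → ℝ, ∀ t ∈ Set.Icc (0:ℝ) 1,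
      P t = ∑ i : Fin (N+1), c i * t ^ (((i:ℕ):ℝ) * σ)) ∧
  ∀ i : Fin (N+1), ∫ t in (0:ℝ)..1, (u t - P t) * t ^ (((i:ℕ):ℝ) * σ) = 0

/-- `P` is the orthogonal projection of the bivariate kernel `k` onto the span of
`{t^(pσ) s^(qσ) : 0 ≤ p,q ≤ N}` in `L²([0,1]×[0,1])`. -/
def IsMuntzProjection2 (σ : ℝ) (N : ℕ) (k P : ℝ → ℝ → ℝ) : Prop :=
  (∃ c : Fin (N+1) → Fin (N+1) → ℝ, ∀ t ∈ Set.Icc (0:ℝ) 1, ∀ s ∈ Set.Icc (0:ℝ) 1,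
      P t s = ∑ p : Fin (N+1), ∑ q : Fin (N+1),
        c p q * t ^ (((p:ℕ):ℝ) * σ) * s ^ (((q:ℕ):ℝ) * σ)) ∧
  ∀ p q : Fin (N+1),
    ∫ t in (0:ℝ)..1, (∫ s in (0:ℝ)..1,
      (k t s - P t s) * s ^ (((q:ℕ):ℝ) * σ)) * t ^ (((p:ℕ):ℝ) * σ) = 0

open Filter Topology in
lemma exists_pos_sum_mul_one_div_rpow_mul_Gamma_le {ι : Type*} [Fintype ι] {α : ι → ι → ℝ}
    (hα : ∀ i j, 0 < α i j) (M : ℝ) :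
    ∃ r > (0 : ℝ), ∀ i, M * ∑ j, (1 / r) ^ α i j * Real.Gamma (α i j) ≤ 1 / 2 := by
  have h : ∀ i, ∀ᶠ r : ℝ in atTop, M * ∑ j, (1 / r) ^ α i j * Real.Gamma (α i j) ≤ 1 / 2 := by
    intro i
    have hlim : Tendsto (fun r : ℝ ↦ M * ∑ j, (1 / r) ^ α i j * Real.Gamma (α i j)) atTop
        (𝓝 (M * ∑ j : ι, 0 ^ α i j * Real.Gamma (α i j))) := by
      refine (tendsto_finsetSum _ fun j _ ↦ Tendsto.mul_const _ ?_).const_mul M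
      refine Tendsto.rpow_const ?_ (Or.inr (hα i j).le)
      exact tendsto_const_nhds.div_atTop tendsto_id
    have hzero : M * ∑ j : ι, (0 : ℝ) ^ α i j * Real.Gamma (α i j) = 0 := by
      simp [Real.zero_rpow (hα i _).ne']
    rw [hzero] at hlim
    exact hlim.eventually_le_const (by norm_num)
  obtain ⟨r, hr, hr0⟩ := ((eventually_all.2 h).and (eventually_gt_atTop 0)).exists
  exact ⟨r, hr0, hr⟩

lemma intervalIntegrable_abel_kernel {a : ℝ} (ha : 0 < a) (t : ℝ) :
    IntervalIntegrable (fun s ↦ (t - s) ^ (a - 1)) volume 0 t := by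
  have h := (intervalIntegral.intervalIntegrable_rpow' (a := 0) (b := t) (r := a - 1)
    (by linarith)).comp_sub_left t
  simpa using h.symm

lemma intervalIntegrable_abel_kernel_mul {a t : ℝ} (ha : 0 < a) (ht : t ∈ Icc (0 : ℝ) 1)
    {f : ℝ → ℝ} (hf : ContinuousOn f (Icc 0 1)) :
    IntervalIntegrable (fun s ↦ (t - s) ^ (a - 1) * f s) volume 0 t := by
  refine (intervalIntegrable_abel_kernel ha t).mul_continuousOn (hf.mono ?_)
  rw [uIcc_of_le ht.1]
  exact Icc_subset_Icc_right ht.2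

lemma integral_abel_kernel_le {a t : ℝ} (ha : 0 < a) (ht : t ∈ Icc (0 : ℝ) 1) :
    ∫ s in (0 : ℝ)..t, (t - s) ^ (a - 1) ≤ 1 / a := by
  rw [intervalIntegral.integral_comp_sub_left (fun s ↦ s ^ (a - 1)) t,
    integral_rpow (Or.inl (by linarith))]
  simp only [sub_self, sub_zero, sub_add_cancel, Real.zero_rpow ha.ne']
  gcongr
  exact Real.rpow_le_one ht.1 ht.2 ha.le

lemma integral_abel_kernel_mul_exp_le {a r t : ℝ} (ha : 0 < a) (hr : 0 < r) (ht : 0 ≤ t) :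
    ∫ s in (0 : ℝ)..t, (t - s) ^ (a - 1) * Real.exp (r * s) ≤
      Real.exp (r * t) * ((1 / r) ^ a * Real.Gamma a) := by
  have hI := Real.integral_rpow_mul_exp_neg_mul_Ioi ha hr
  have hint : IntegrableOn (fun u : ℝ ↦ u ^ (a - 1) * Real.exp (-(r * u))) (Ioi 0) := by
    by_contra h
    rw [integral_undef h] at hI
    have := Real.Gamma_pos_of_pos ha
    have : 0 < (1 / r) ^ a * Real.Gamma a := by positivity
    linarith
  have hshift : ∫ s in (0 : ℝ)..t, (t - s) ^ (a - 1) * Real.exp (r * s) =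
      Real.exp (r * t) * ∫ u in (0 : ℝ)..t, u ^ (a - 1) * Real.exp (-(r * u)) := by
    have h := intervalIntegral.integral_comp_sub_left (a := 0) (b := t)
      (fun u ↦ u ^ (a - 1) * Real.exp (-(r * u))) t
    simp only [sub_self, sub_zero] at h
    rw [← h, ← intervalIntegral.integral_const_mul]
    congr 1 with s
    rw [mul_left_comm, ← Real.exp_add]
    ring_nf
  rw [hshift, ← hI, intervalIntegral.integral_of_le ht]
  refine mul_le_mul_of_nonneg_left
    (setIntegral_mono_set hint ?_ Ioc_subset_Ioi_self.eventuallyLE) (Real.exp_pos _).le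
  filter_upwards [ae_restrict_mem measurableSet_Ioi] with u hu
  have : 0 < u := hu
  positivity

/-- A Gronwall inequality for systems with Abel-type kernels. -/
lemma exists_abel_gronwall_const {ι : Type*} [Fintype ι] {α : ι → ι → ℝ}
    (hα : ∀ i j, 0 < α i j) {M : ℝ} (hM : 0 ≤ M) :
    ∃ C > (0 : ℝ), ∀ (A : ℝ) (e : ι → ℝ → ℝ), (∀ i, ContinuousOn (e i) (Icc 0 1)) →
      (∀ i, ∀ t ∈ Icc (0 : ℝ) 1,
        |e i t| ≤ A + M * ∑ j, ∫ s in (0 : ℝ)..t, (t - s) ^ (α i j - 1) * |e j s|) →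
      ∀ i, ∀ t ∈ Icc (0 : ℝ) 1, |e i t| ≤ C * A := by
  obtain ⟨r, hr, hrM⟩ := exists_pos_sum_mul_one_div_rpow_mul_Gamma_le hα M
  refine ⟨2 * Real.exp r, by positivity, fun A e he hle i t ht ↦ ?_⟩
  have hmax : ∀ j, ∃ t ∈ Icc (0 : ℝ) 1, IsMaxOn (fun t ↦ Real.exp (-(r * t)) * |e j t|)
      (Icc 0 1) t := fun j ↦
    isCompact_Icc.exists_isMaxOn ⟨0, by simp⟩ (ContinuousOn.mul (by fun_prop) (he j).abs)
  choose τ hτ hτmax using hmax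
  have : Nonempty ι := ⟨i⟩
  obtain ⟨m, hm⟩ := Finite.exists_max fun j ↦ Real.exp (-(r * τ j)) * |e j (τ j)|
  set S := Real.exp (-(r * τ m)) * |e m (τ m)| with hS
  have hS0 : 0 ≤ S := by positivity
  have hbound : ∀ j, ∀ s ∈ Icc (0 : ℝ) 1, |e j s| ≤ S * Real.exp (r * s) := by
    intro j s hs
    have h : Real.exp (-(r * s)) * |e j s| ≤ S := (hτmax j hs).trans (hm j)
    rwa [Real.exp_neg, inv_mul_le_iff₀ (Real.exp_pos _), mul_comm] at h
  have hint : ∀ j, ∫ s in (0 : ℝ)..τ m, (τ m - s) ^ (α m j - 1) * |e j s| ≤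
      S * Real.exp (r * τ m) * ((1 / r) ^ α m j * Real.Gamma (α m j)) := by
    intro j
    calc _ ≤ ∫ s in (0 : ℝ)..τ m, S * ((τ m - s) ^ (α m j - 1) * Real.exp (r * s)) := by
          refine intervalIntegral.integral_mono_on (hτ m).1
            (intervalIntegrable_abel_kernel_mul (hα m j) (hτ m) (he j).abs)
            ((intervalIntegrable_abel_kernel_mul (hα m j) (hτ m) (by fun_prop)).const_mul S)
            fun s hs ↦ ?_
          have := hbound j s ⟨hs.1, hs.2.trans (hτ m).2⟩
          have := Real.rpow_nonneg (sub_nonneg.2 hs.2) (α m j - 1)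
          calc _ ≤ (τ m - s) ^ (α m j - 1) * (S * Real.exp (r * s)) := by gcongr
            _ = _ := by ring
      _ ≤ _ := by
          rw [intervalIntegral.integral_const_mul, mul_assoc S]
          exact mul_le_mul_of_nonneg_left
            (integral_abel_kernel_mul_exp_le (hα m j) hr (hτ m).1) hS0
  have hm' : |e m (τ m)| ≤ A + S * Real.exp (r * τ m) * (1 / 2) :=
    calc _ ≤ _ := hle m (τ m) (hτ m)
      _ ≤ A + M * ∑ j, S * Real.exp (r * τ m) * ((1 / r) ^ α m j * Real.Gamma (α m j)) := by
          gcongr with j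
          exact hint j
      _ = A + S * Real.exp (r * τ m) *
            (M * ∑ j, (1 / r) ^ α m j * Real.Gamma (α m j)) := by
          rw [← Finset.mul_sum]; ring
      _ ≤ _ := by gcongr; exact hrM m
  have hSm : S * Real.exp (r * τ m) = |e m (τ m)| := by
    rw [hS, mul_right_comm, ← Real.exp_add]; simp
  have hA : 0 ≤ A := by linarith [abs_nonneg (e m (τ m))]
  have hSA : S ≤ 2 * A := by
    have h1 : 1 ≤ Real.exp (r * τ m) := Real.one_le_exp (mul_nonneg hr.le (hτ m).1)
    nlinarith
  calc |e i t| ≤ S * Real.exp (r * t) := hbound i t ht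
    _ ≤ 2 * A * Real.exp r := by
        gcongr
        nlinarith [ht.2]
    _ = _ := by ring

lemma IsMuntzProjection.continuousOn {σ : ℝ} (hσ : 0 ≤ σ) {N : ℕ} {u P : ℝ → ℝ}
    (h : IsMuntzProjection σ N u P) : ContinuousOn P (Icc 0 1) := by
  obtain ⟨⟨c, hc⟩, -⟩ := h
  refine ContinuousOn.congr ?_ hc
  exact (continuous_finsetSum _ fun i _ ↦ continuous_const.mul
    (Real.continuous_rpow_const (by positivity))).continuousOn

lemma IsMuntzProjection2.continuousOn {σ : ℝ} (hσ : 0 ≤ σ) {N : ℕ} {k P : ℝ → ℝ → ℝ}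
    (h : IsMuntzProjection2 σ N k P) :
    ContinuousOn (fun p : ℝ × ℝ ↦ P p.1 p.2) (Icc (0 : ℝ) 1 ×ˢ Icc (0 : ℝ) 1) := by
  obtain ⟨⟨c, hc⟩, -⟩ := h
  refine ContinuousOn.congr ?_ fun p hp ↦ hc p.1 hp.1 p.2 hp.2
  refine (continuous_finsetSum _ fun i _ ↦ continuous_finsetSum _ fun j _ ↦
    (continuous_const.mul ?_).mul ?_).continuousOn
  · exact (Real.continuous_rpow_const (by positivity)).comp continuous_fst
  · exact (Real.continuous_rpow_const (by positivity)).comp continuous_snd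

lemma abs_le_iSup_iSup_of_continuousOn {ι : Type*} [Finite ι] {f : ι → ℝ → ℝ}
    (hf : ∀ i, ContinuousOn (f i) (Icc 0 1)) (i : ι) {t : ℝ} (ht : t ∈ Icc (0 : ℝ) 1) :
    |f i t| ≤ ⨆ l, ⨆ t : Icc (0 : ℝ) 1, |f l t.1| := by
  obtain ⟨B, hB⟩ := isCompact_Icc.exists_bound_of_continuousOn (hf i)
  have hbdd : BddAbove (range fun t : Icc (0 : ℝ) 1 ↦ |f i t.1|) :=
    ⟨B, by rintro _ ⟨t, rfl⟩; exact hB t.1 t.2⟩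
  exact (le_ciSup hbdd ⟨t, ht⟩).trans
    (le_ciSup (f := fun l ↦ ⨆ t : Icc (0 : ℝ) 1, |f l t.1|) (finite_range _).bddAbove i)

lemma abs_le_iSup_iSup_iSup_iSup_of_continuousOn {ι κ : Type*} [Finite ι] [Finite κ]
    {f : ι → κ → ℝ → ℝ → ℝ}
    (hf : ∀ i j, ContinuousOn (fun p : ℝ × ℝ ↦ f i j p.1 p.2) (Icc (0 : ℝ) 1 ×ˢ Icc (0 : ℝ) 1))
    (i : ι) (j : κ) {t s : ℝ} (ht : t ∈ Icc (0 : ℝ) 1) (hs : s ∈ Icc (0 : ℝ) 1) :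
    |f i j t s| ≤ ⨆ l, ⨆ j, ⨆ t : Icc (0 : ℝ) 1, ⨆ s : Icc (0 : ℝ) 1, |f l j t.1 s.1| := by
  obtain ⟨B, hB⟩ := (isCompact_Icc.prod isCompact_Icc).exists_bound_of_continuousOn (hf i j)
  have hB' : ∀ t s : Icc (0 : ℝ) 1, |f i j t.1 s.1| ≤ B := fun t s ↦ hB (t.1, s.1) ⟨t.2, s.2⟩
  have : Nonempty (Icc (0 : ℝ) 1) := ⟨⟨t, ht⟩⟩
  have hs_bdd : BddAbove (range fun s : Icc (0 : ℝ) 1 ↦ |f i j t s.1|) :=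
    ⟨B, by rintro _ ⟨s, rfl⟩; exact hB' ⟨t, ht⟩ s⟩
  have ht_bdd : BddAbove (range fun t : Icc (0 : ℝ) 1 ↦ ⨆ s : Icc (0 : ℝ) 1, |f i j t.1 s.1|) :=
    ⟨B, by rintro _ ⟨t, rfl⟩; exact ciSup_le (hB' t)⟩
  calc |f i j t s| ≤ ⨆ s : Icc (0 : ℝ) 1, |f i j t s.1| := le_ciSup hs_bdd ⟨s, hs⟩
    _ ≤ ⨆ t : Icc (0 : ℝ) 1, ⨆ s : Icc (0 : ℝ) 1, |f i j t.1 s.1| := le_ciSup ht_bdd ⟨t, ht⟩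
    _ ≤ ⨆ j, ⨆ t : Icc (0 : ℝ) 1, ⨆ s : Icc (0 : ℝ) 1, |f i j t.1 s.1| :=
        le_ciSup (f := fun j ↦ ⨆ t : Icc (0 : ℝ) 1, ⨆ s : Icc (0 : ℝ) 1, |f i j t.1 s.1|)
          (finite_range _).bddAbove j
    _ ≤ _ :=
        le_ciSup (f := fun l ↦ ⨆ j, ⨆ t : Icc (0 : ℝ) 1, ⨆ s : Icc (0 : ℝ) 1, |f l j t.1 s.1|)
          (finite_range _).bddAbove i

lemma continuousOn_section {k : ℝ → ℝ → ℝ}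
    (hk : ContinuousOn (fun p : ℝ × ℝ ↦ k p.1 p.2) (Icc (0 : ℝ) 1 ×ˢ Icc (0 : ℝ) 1))
    {t : ℝ} (ht : t ∈ Icc (0 : ℝ) 1) : ContinuousOn (k t) (Icc 0 1) :=
  hk.comp (f := fun s : ℝ ↦ (t, s)) (by fun_prop) fun _ hs ↦ ⟨ht, hs⟩

/-- The difference of two Abel–Volterra integrals, in terms of the differences of the kernels and
of the integrands. -/
lemma abs_abel_integral_sub_le {a t M D : ℝ} (ha : 0 < a) (ht : t ∈ Icc (0 : ℝ) 1)
    {p q u v : ℝ → ℝ} (hp : ContinuousOn p (Icc 0 1)) (hq : ContinuousOn q (Icc 0 1))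
    (hu : ContinuousOn u (Icc 0 1)) (hv : ContinuousOn v (Icc 0 1))
    (hpM : ∀ s ∈ Icc (0 : ℝ) 1, |p s| ≤ M) (hD : ∀ s ∈ Icc (0 : ℝ) 1, |p s - q s| * |v s| ≤ D) :
    |(∫ s in (0 : ℝ)..t, (t - s) ^ (a - 1) * p s * u s) -
        ∫ s in (0 : ℝ)..t, (t - s) ^ (a - 1) * q s * v s| ≤
      M * (∫ s in (0 : ℝ)..t, (t - s) ^ (a - 1) * |u s - v s|) + 1 / a * D := by
  have hD0 : 0 ≤ D := (by positivity : 0 ≤ |p t - q t| * |v t|).trans (hD t ht)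
  have hI₁ : IntervalIntegrable (fun s ↦ M * ((t - s) ^ (a - 1) * |u s - v s|)) volume 0 t :=
    (intervalIntegrable_abel_kernel_mul ha ht (hu.sub hv).abs).const_mul M
  have hI₂ := (intervalIntegrable_abel_kernel ha t).mul_const D
  simp only [mul_assoc]
  rw [← intervalIntegral.integral_sub
      (intervalIntegrable_abel_kernel_mul ha ht (f := fun s ↦ p s * u s) (hp.mul hu))
      (intervalIntegrable_abel_kernel_mul ha ht (f := fun s ↦ q s * v s) (hq.mul hv))]
  calc _ ≤ ∫ s in (0 : ℝ)..t,
        (M * ((t - s) ^ (a - 1) * |u s - v s|) + (t - s) ^ (a - 1) * D) := by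
        rw [← Real.norm_eq_abs]
        refine intervalIntegral.norm_integral_le_of_norm_le ht.1
          (Filter.Eventually.of_forall fun s hs ↦ ?_) (hI₁.add hI₂)
        have hs' : s ∈ Icc (0 : ℝ) 1 := ⟨hs.1.le, hs.2.trans ht.2⟩
        have h0 := Real.rpow_nonneg (sub_nonneg.2 hs.2) (a - 1)
        have hsplit : (t - s) ^ (a - 1) * (p s * u s) - (t - s) ^ (a - 1) * (q s * v s) =
            (t - s) ^ (a - 1) * (p s * (u s - v s) + (p s - q s) * v s) := by ring
        rw [hsplit, Real.norm_eq_abs, abs_mul, abs_of_nonneg h0]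
        calc _ ≤ (t - s) ^ (a - 1) * (M * |u s - v s| + D) := by
              gcongr
              refine (abs_add_le _ _).trans ?_
              rw [abs_mul, abs_mul]
              gcongr
              exacts [hpM s hs', hD s hs']
          _ = _ := by ring
    _ = M * (∫ s in (0 : ℝ)..t, (t - s) ^ (a - 1) * |u s - v s|) +
          (∫ s in (0 : ℝ)..t, (t - s) ^ (a - 1)) * D := by
        rw [intervalIntegral.integral_add hI₁ hI₂, intervalIntegral.integral_const_mul,
          intervalIntegral.integral_mul_const]
    _ ≤ _ := by
        gcongr
        exact integral_abel_kernel_le ha ht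

/-- **Error bound for the recursive Tau approximation of a system of generalized
Abel–Volterra integral equations.** If `y` is the exact continuous solution of
`y i t = g i t + ∑ j ∫₀ᵗ (t-s)^(α i j - 1) k i j t s ⬝ y j s ds` on `[0,1]`, and
for each `N` the continuous functions `yN i`, `HN i` satisfy the perturbed
equations with Müntz-projected data
`yN i t = HN i t + (Π_{N,σ} g i) t + ∑ j ∫₀ᵗ (t-s)^(α i j - 1) (Π_{N,σ} k i j)(t,s) yN j s ds`,
then there is `C > 0` independent of `N` such that for every `N` and `i`,
`‖y i - yN i‖_∞ ≤ C (max_l ‖HN l‖_∞ + max_l ‖g l - Π_{N,σ} g l‖_∞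
  + max_{l,j} ‖k l j - Π_{N,σ} k l j‖_∞ (max_j ‖y j‖_∞ + max_j ‖y j - yN j‖_∞))`. -/
theorem tau_approximation_error_bound
    (n : ℕ) (hn : 1 ≤ n) (σ : ℝ) (hσ : σ ∈ Set.Ioo (0:ℝ) 1)
    (α : Fin n → Fin n → ℝ) (hα : ∀ i j, α i j ∈ Set.Ioc (0:ℝ) 1)
    (k : Fin n → Fin n → ℝ → ℝ → ℝ)
    (hk : ∀ i j, ContinuousOn (fun p : ℝ × ℝ => k i j p.1 p.2)
        (Set.Icc (0:ℝ) 1 ×ˢ Set.Icc (0:ℝ) 1))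
    (g : Fin n → ℝ → ℝ) (hg : ∀ i, ContinuousOn (g i) (Set.Icc 0 1))
    (y : Fin n → ℝ → ℝ) (hycont : ∀ i, ContinuousOn (y i) (Set.Icc 0 1))
    (hysol : ∀ i, ∀ t ∈ Set.Icc (0:ℝ) 1,
        y i t = g i t + ∑ j, ∫ s in (0:ℝ)..t,
          (t - s) ^ (α i j - 1) * k i j t s * y j s) :
    ∃ C > (0:ℝ), ∀ N : ℕ,
      ∀ (gN : Fin n → ℝ → ℝ) (kN : Fin n → Fin n → ℝ → ℝ → ℝ)
        (yN HN : Fin n → ℝ → ℝ),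
      (∀ i, IsMuntzProjection σ N (g i) (gN i)) →
      (∀ i j, IsMuntzProjection2 σ N (k i j) (kN i j)) →
      (∀ i, ContinuousOn (yN i) (Set.Icc 0 1)) →
      (∀ i, ContinuousOn (HN i) (Set.Icc 0 1)) →
      (∀ i, ∀ t ∈ Set.Icc (0:ℝ) 1,
        yN i t = HN i t + gN i t + ∑ j, ∫ s in (0:ℝ)..t,
          (t - s) ^ (α i j - 1) * kN i j t s * yN j s) →
      ∀ i, (⨆ t : Set.Icc (0:ℝ) 1, |y i t.1 - yN i t.1|) ≤
        C * ((⨆ l, ⨆ t : Set.Icc (0:ℝ) 1, |HN l t.1|) +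
             (⨆ l, ⨆ t : Set.Icc (0:ℝ) 1, |g l t.1 - gN l t.1|) +
             (⨆ l, ⨆ j, ⨆ t : Set.Icc (0:ℝ) 1, ⨆ s : Set.Icc (0:ℝ) 1,
                |k l j t.1 s.1 - kN l j t.1 s.1|) *
               ((⨆ j, ⨆ t : Set.Icc (0:ℝ) 1, |y j t.1|) +
                (⨆ j, ⨆ t : Set.Icc (0:ℝ) 1, |y j t.1 - yN j t.1|))) := by
  have hα0 : ∀ i j, 0 < α i j := fun i j ↦ (hα i j).1
  choose B hB using fun i j ↦
    (isCompact_Icc.prod isCompact_Icc).exists_bound_of_continuousOn (hk i j)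
  obtain ⟨M₀, hM₀⟩ := (finite_range fun p : Fin n × Fin n ↦ B p.1 p.2).bddAbove
  have hkM : ∀ i j, ∀ t ∈ Icc (0 : ℝ) 1, ∀ s ∈ Icc (0 : ℝ) 1, |k i j t s| ≤ max M₀ 0 :=
    fun i j t ht s hs ↦ (hB i j (t, s) ⟨ht, hs⟩).trans
      ((hM₀ ⟨(i, j), rfl⟩).trans (le_max_left _ _))
  generalize max M₀ 0 = M at hkM
  obtain ⟨C, hC, hgronwall⟩ := exists_abel_gronwall_const hα0 (abs_nonneg M)
  obtain ⟨W₀, hW₀⟩ := (finite_range fun i ↦ ∑ j, 1 / α i j).bddAbove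
  refine ⟨C * max W₀ 1, by positivity, ?_⟩
  intro N gN kN yN HN hgN hkN hyN hHN hyNsol
  have hdcont : ∀ i, ContinuousOn (fun t ↦ y i t - yN i t) (Icc 0 1) :=
    fun i ↦ (hycont i).sub (hyN i)
  have hH := fun i t ht ↦ abs_le_iSup_iSup_of_continuousOn hHN i (t := t) ht
  have hG := fun i t ht ↦ abs_le_iSup_iSup_of_continuousOn (f := fun l t ↦ g l t - gN l t)
    (fun l ↦ (hg l).sub ((hgN l).continuousOn hσ.1.le)) i (t := t) ht
  have hY := fun i t ht ↦ abs_le_iSup_iSup_of_continuousOn hycont i (t := t) ht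
  have hE := fun i t ht ↦ abs_le_iSup_iSup_of_continuousOn hdcont i (t := t) ht
  have hK := fun i j t s ht hs ↦ abs_le_iSup_iSup_iSup_iSup_of_continuousOn
    (f := fun l j t s ↦ k l j t s - kN l j t s)
    (fun l j ↦ (hk l j).sub ((hkN l j).continuousOn hσ.1.le)) i j (t := t) (s := s) ht hs
  intro i
  have : Nonempty (Icc (0 : ℝ) 1) := ⟨⟨0, by simp⟩⟩
  refine ciSup_le fun t ↦ ?_
  revert hH hG hY hE hK
  generalize (⨆ l, ⨆ t : Icc (0 : ℝ) 1, |HN l t.1|) = H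
  generalize (⨆ l, ⨆ t : Icc (0 : ℝ) 1, |g l t.1 - gN l t.1|) = G
  generalize (⨆ l, ⨆ t : Icc (0 : ℝ) 1, |y l t.1|) = Y
  generalize (⨆ l, ⨆ t : Icc (0 : ℝ) 1, |y l t.1 - yN l t.1|) = E
  generalize (⨆ l, ⨆ j, ⨆ t : Icc (0 : ℝ) 1, ⨆ s : Icc (0 : ℝ) 1,
    |k l j t.1 s.1 - kN l j t.1 s.1|) = K
  intro hH hG hY hE hK
  have hH0 : 0 ≤ H := (abs_nonneg _).trans (hH i t t.2)
  have hG0 : 0 ≤ G := (abs_nonneg _).trans (hG i t t.2)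
  have hY0 : 0 ≤ Y := (abs_nonneg _).trans (hY i t t.2)
  have hE0 : 0 ≤ E := (abs_nonneg _).trans (hE i t t.2)
  have hK0 : 0 ≤ K := (abs_nonneg _).trans (hK i i t t t.2 t.2)
  rw [mul_assoc]
  refine hgronwall _ (fun i t ↦ y i t - yN i t) hdcont (fun i t ht ↦ ?_) i t t.2
  have hdiff : ∀ j, _ := fun j ↦ abs_abel_integral_sub_le (M := |M|) (D := K * (Y + E)) (hα0 i j) ht
    (continuousOn_section (hk i j) ht)
    (continuousOn_section ((hkN i j).continuousOn hσ.1.le) ht) (hycont j) (hyN j)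
    (fun s hs ↦ (hkM i j t ht s hs).trans (le_abs_self M)) fun s hs ↦ by
      have hyNs : |yN j s| ≤ Y + E := by
        have h := abs_sub (y j s) (y j s - yN j s)
        rw [sub_sub_cancel] at h
        linarith [hY j s hs, hE j s hs]
      gcongr
      exact hK i j t s ht hs
  have hsplit : y i t - yN i t = (g i t - gN i t) - HN i t +
      ∑ j, ((∫ s in (0 : ℝ)..t, (t - s) ^ (α i j - 1) * k i j t s * y j s) -
        ∫ s in (0 : ℝ)..t, (t - s) ^ (α i j - 1) * kN i j t s * yN j s) := by
    rw [hysol i t ht, hyNsol i t ht, Finset.sum_sub_distrib]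
    ring
  have hsum := (Finset.abs_sum_le_sum_abs _ _).trans
    (Finset.sum_le_sum fun j (_ : j ∈ Finset.univ) ↦ hdiff j)
  rw [Finset.sum_add_distrib, ← Finset.mul_sum, ← Finset.sum_mul] at hsum
  have hW : (∑ j, 1 / α i j) * (K * (Y + E)) ≤ max W₀ 1 * (K * (Y + E)) := by
    gcongr
    exact (hW₀ ⟨i, rfl⟩).trans (le_max_left _ _)
  have hHG : H + G ≤ max W₀ 1 * (H + G) :=
    le_mul_of_one_le_left (by positivity) (le_max_right _ _)
  have htri := (abs_add_le ((g i t - gN i t) - HN i t) (∑ j,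
    ((∫ s in (0 : ℝ)..t, (t - s) ^ (α i j - 1) * k i j t s * y j s) -
        ∫ s in (0 : ℝ)..t, (t - s) ^ (α i j - 1) * kN i j t s * yN j s))).trans
    (add_le_add (abs_sub _ _) hsum)
  rw [← hsplit] at htri
  rw [mul_add]
  linarith [hH i t ht, hG i t ht]
end
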